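/- arXiv:1711.00980 — 3 statements merged into one kernel-verified Lean document; each statement's English description precedes it below -/
import Mathlib

section
/- Let p be a prime, R a commutative ring, 𝔞 ⊆ R an ideal, and n ≥ 1. If a subset S ⊆ 𝔞 generates 𝔞 as an additive group, then the additive group W_n(𝔞) := {x ∈ W_n(R) : x.coeff i ∈ 𝔞 for all 0 ≤ i ≤ n−1} is generated, as an additive group, by the elements V^i([s]) for s ∈ S and 0 ≤ i ≤ n−1. -/
noncomputable section

namespace TruncatedWittVector

variable {p n : ℕ} [hp : Fact p.Prime] {R : Type*} [CommRing R]

/-- Verschiebung on truncated Witt vectors: `(x₀,…,x_{n-1}) ↦ (0,x₀,…,x_{n-2})`. -/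
def vers (x : TruncatedWittVector p n R) : TruncatedWittVector p n R :=
  WittVector.truncate n (WittVector.verschiebung x.out)

/-- Teichmüller representative `[a] = (a,0,…,0)` in truncated Witt vectors. -/
def teich (a : R) : TruncatedWittVector p n R :=
  WittVector.truncate n (WittVector.teichmuller p a)

end TruncatedWittVector

namespace WittVector

variable {p : ℕ} [Fact p.Prime] {R : Type*} [CommRing R]

theorem mem_ker_map_mk_iff (𝔞 : Ideal R) (x : WittVector p R) :
    x ∈ RingHom.ker (map (p := p) (Ideal.Quotient.mk 𝔞)) ↔ ∀ i, x.coeff i ∈ 𝔞 := by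
  simp only [RingHom.mem_ker, WittVector.ext_iff, map_coeff, zero_coeff,
    Ideal.Quotient.eq_zero_iff_mem]

theorem iterate_verschiebung_teichmuller_mem_ker_map_mk {𝔞 : Ideal R} {a : R} (ha : a ∈ 𝔞)
    (i : ℕ) :
    verschiebung^[i] (teichmuller p a) ∈ RingHom.ker (map (p := p) (Ideal.Quotient.mk 𝔞)) := by
  induction i with
  | zero =>
    rw [Function.iterate_zero_apply, RingHom.mem_ker, map_teichmuller,
      Ideal.Quotient.eq_zero_iff_mem.2 ha, teichmuller_zero]
  | succ i ih =>
    rw [RingHom.mem_ker] at ih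
    rw [Function.iterate_succ_apply', RingHom.mem_ker, map_verschiebung, ih, map_zero]

theorem exists_mem_closure_teichmuller_coeff_zero_eq {S : Set R} {a : R}
    (ha : a ∈ AddSubgroup.closure S) :
    ∃ h ∈ AddSubgroup.closure (teichmuller p '' S), h.coeff 0 = a := by
  have key : (AddSubgroup.closure (teichmuller p '' S)).map
      (constantCoeff (p := p) (R := R)).toAddMonoidHom = AddSubgroup.closure S := by
    rw [AddMonoidHom.map_closure, Set.image_image]
    congr 1
    convert Set.image_id S using 2
    exact teichmuller_coeff_zero p _
  rw [← key] at ha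
  exact ha

theorem exists_verschiebung_eq {x : WittVector p R} (hx : x.coeff 0 = 0) :
    ∃ y, verschiebung y = x :=
  ⟨mk p fun i => x.coeff (i + 1), by ext i; cases i <;> simp [hx]⟩

/-- A Witt vector with coefficients in `𝔞` is, up to a Witt vector in `V^n (W(𝔞))`, a `ℤ`-linear
combination of the `V^i([s])` with `s ∈ S` and `i < n`. -/
theorem exists_mem_closure_add_iterate_verschiebung {𝔞 : Ideal R} {S : Set R}
    (hgen : AddSubgroup.closure S = 𝔞.toAddSubgroup) {x : WittVector p R}
    (hx : x ∈ RingHom.ker (map (p := p) (Ideal.Quotient.mk 𝔞))) (n : ℕ) :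
    ∃ g ∈ AddSubgroup.closure
        {y : WittVector p R | ∃ s ∈ S, ∃ i < n, y = verschiebung^[i] (teichmuller p s)},
      ∃ y ∈ RingHom.ker (map (p := p) (Ideal.Quotient.mk 𝔞)), x = g + verschiebung^[n] y := by
  have hS : ∀ s ∈ S, s ∈ 𝔞 := fun s hs =>
    (hgen.le (AddSubgroup.subset_closure hs) : s ∈ 𝔞.toAddSubgroup)
  induction n with
  | zero => exact ⟨0, zero_mem _, x, hx, by simp⟩
  | succ n ih =>
    obtain ⟨g, hg, y, hy, rfl⟩ := ih
    have hy0 : y.coeff 0 ∈ AddSubgroup.closure S := by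
      rw [hgen]
      exact (mem_ker_map_mk_iff 𝔞 y).1 hy 0
    obtain ⟨h, hh, hh0⟩ := exists_mem_closure_teichmuller_coeff_zero_eq (p := p) hy0
    have hhK : h ∈ RingHom.ker (map (p := p) (Ideal.Quotient.mk 𝔞)) := by
      have hle : AddSubgroup.closure (teichmuller p '' S) ≤
          (RingHom.ker (map (p := p) (Ideal.Quotient.mk 𝔞))).toAddSubgroup := by
        rw [AddSubgroup.closure_le]
        rintro _ ⟨s, hs, rfl⟩
        exact iterate_verschiebung_teichmuller_mem_ker_map_mk (hS s hs) 0
      exact hle hh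
    obtain ⟨z, hz⟩ := exists_verschiebung_eq (x := y - h) <| by
      change constantCoeff (y - h) = 0
      rw [map_sub, sub_eq_zero]
      exact hh0.symm
    refine ⟨g + verschiebung^[n] h, add_mem ?_ ?_, z, ?_, ?_⟩
    · refine AddSubgroup.closure_mono ?_ hg
      rintro _ ⟨s, hs, i, hi, rfl⟩
      exact ⟨s, hs, i, hi.trans n.lt_succ_self, rfl⟩
    · clear hh0 hhK hz
      induction hh using AddSubgroup.closure_induction with
      | mem _ hmem =>
        obtain ⟨s, hs, rfl⟩ := hmem
        exact AddSubgroup.subset_closure ⟨s, hs, n, n.lt_succ_self, rfl⟩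
      | zero => rw [iterate_map_zero]; exact zero_mem _
      | add _ _ _ _ h₁ h₂ => rw [iterate_map_add]; exact add_mem h₁ h₂
      | neg _ _ h₁ => rw [iterate_map_neg]; exact neg_mem h₁
    · rw [mem_ker_map_mk_iff]
      intro i
      rw [← verschiebung_coeff_succ, hz]
      exact (mem_ker_map_mk_iff 𝔞 _).1 (sub_mem hy hhK) _
    · rw [Function.iterate_succ_apply, hz, iterate_map_sub]
      abel

theorem iterate_verschiebung_coeff_of_lt (x : WittVector p R) {i n : ℕ} (h : i < n) :
    (verschiebung^[n] x).coeff i = 0 := by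
  induction n generalizing i with
  | zero => omega
  | succ n ih =>
    rw [Function.iterate_succ_apply']
    cases i with
    | zero => exact verschiebung_coeff_zero _
    | succ i => rw [verschiebung_coeff_succ]; exact ih (by omega)

theorem truncate_iterate_verschiebung_self (x : WittVector p R) (n : ℕ) :
    truncate n (verschiebung^[n] x) = 0 :=
  TruncatedWittVector.ext fun i => by
    rw [coeff_truncate, iterate_verschiebung_coeff_of_lt x i.2, TruncatedWittVector.coeff_zero]

end WittVector

namespace TruncatedWittVector

variable {p n : ℕ} [Fact p.Prime] {R : Type*} [CommRing R]

theorem vers_truncate (x : WittVector p R) :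
    vers (WittVector.truncate n x) = WittVector.truncate n (WittVector.verschiebung x) := by
  ext ⟨i, hi⟩
  rw [vers, WittVector.coeff_truncate, WittVector.coeff_truncate]
  cases i with
  | zero => simp
  | succ i =>
    simp only [WittVector.verschiebung_coeff_succ]
    exact (coeff_out _ ⟨i, by omega⟩).trans (WittVector.coeff_truncate x ⟨i, by omega⟩)

theorem iterate_vers_teich (i : ℕ) (a : R) :
    vers^[i] (teich a : TruncatedWittVector p n R) =
      WittVector.truncate n (WittVector.verschiebung^[i] (WittVector.teichmuller p a)) := by
  induction i with
  | zero => rfl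
  | succ i ih => rw [Function.iterate_succ_apply', ih, vers_truncate, Function.iterate_succ_apply']

theorem forall_coeff_mem_iff (𝔞 : Ideal R) (x : TruncatedWittVector p n R) :
    (∀ i : Fin n, x.coeff i ∈ 𝔞) ↔
      ∃ y ∈ RingHom.ker (WittVector.map (p := p) (Ideal.Quotient.mk 𝔞)),
        WittVector.truncate n y = x := by
  constructor
  · intro hx
    refine ⟨x.out, (WittVector.mem_ker_map_mk_iff 𝔞 _).2 fun i => ?_, truncateFun_out x⟩
    by_cases hi : i < n
    · simpa using (coeff_out x ⟨i, hi⟩).symm ▸ hx ⟨i, hi⟩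
    · simp [out, hi]
  · rintro ⟨y, hy, rfl⟩ i
    rw [WittVector.coeff_truncate]
    exact (WittVector.mem_ker_map_mk_iff 𝔞 y).1 hy i

end TruncatedWittVector

/-- If `S ⊆ 𝔞` generates the ideal `𝔞` as an additive group, then the
additive group `W_n(𝔞) = {x ∈ W_n(R) : x.coeff i ∈ 𝔞 for all i}` is generated, as an
additive group, by the elements `V^i([s])` for `s ∈ S` and `0 ≤ i ≤ n−1`. -/
theorem truncatedWittVector_ideal_addGroup_generators
    (p : ℕ) [Fact p.Prime] (R : Type*) [CommRing R] (𝔞 : Ideal R) (n : ℕ) (hn : 1 ≤ n)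
    (S : Set R) (hS𝔞 : S ⊆ (𝔞 : Set R))
    (hgen : AddSubgroup.closure S = 𝔞.toAddSubgroup) :
    ∀ x : TruncatedWittVector p n R,
      (∀ i : Fin n, x.coeff i ∈ 𝔞) ↔
        x ∈ AddSubgroup.closure
          {y : TruncatedWittVector p n R |
            ∃ s ∈ S, ∃ i < n, y = TruncatedWittVector.vers^[i] (TruncatedWittVector.teich s)} := by
  intro x
  have himage : {y : TruncatedWittVector p n R |
      ∃ s ∈ S, ∃ i < n, y = TruncatedWittVector.vers^[i] (TruncatedWittVector.teich s)} =
      WittVector.truncate n '' {y : WittVector p R |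
        ∃ s ∈ S, ∃ i < n, y = WittVector.verschiebung^[i] (WittVector.teichmuller p s)} := by
    ext y
    constructor
    · rintro ⟨s, hs, i, hi, rfl⟩
      exact ⟨_, ⟨s, hs, i, hi, rfl⟩, (TruncatedWittVector.iterate_vers_teich i s).symm⟩
    · rintro ⟨_, ⟨s, hs, i, hi, rfl⟩, rfl⟩
      exact ⟨s, hs, i, hi, (TruncatedWittVector.iterate_vers_teich i s).symm⟩
  have hmap := AddMonoidHom.map_closure
    (WittVector.truncate (p := p) (R := R) n).toAddMonoidHom {y : WittVector p R |
        ∃ s ∈ S, ∃ i < n, y = WittVector.verschiebung^[i] (WittVector.teichmuller p s)}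
  rw [himage, TruncatedWittVector.forall_coeff_mem_iff]
  refine Iff.trans ?_ (Iff.of_eq (congrArg (x ∈ ·) hmap))
  constructor
  · rintro ⟨y, hy, rfl⟩
    obtain ⟨g, hg, z, -, rfl⟩ :=
      WittVector.exists_mem_closure_add_iterate_verschiebung hgen hy n
    refine ⟨g, hg, ?_⟩
    rw [map_add, WittVector.truncate_iterate_verschiebung_self, add_zero]
    rfl
  · rintro ⟨y, hy, rfl⟩
    refine ⟨y, ?_, rfl⟩
    have hle : AddSubgroup.closure {y : WittVector p R |
        ∃ s ∈ S, ∃ i < n, y = WittVector.verschiebung^[i] (WittVector.teichmuller p s)} ≤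
        (RingHom.ker (WittVector.map (p := p) (Ideal.Quotient.mk 𝔞))).toAddSubgroup := by
      rw [AddSubgroup.closure_le]
      rintro _ ⟨s, hs, i, -, rfl⟩
      exact WittVector.iterate_verschiebung_teichmuller_mem_ker_map_mk (hS𝔞 hs) i
    exact hle hy
end
end

section
/- Let K be a field of characteristic p > 0, n ≥ 1, and b ∈ K with b ≠ 0. Let Ω be an algebraic closure of K and let α = (α_0,…,α_{n−1}) ∈ W_n(Ω) be a Witt vector satisfying F(α) − α = [b], where [b] is the Teichmüller representative of b in W_n(Ω). Let L = K(α_0,…,α_{n−1}) be the intermediate field of Ω/K generated by the coefficients of α. Then L is a finite extension of K and b lies in the image of the norm map N_{L/K} : L^× → K^×. (This is the statement that the Artin–Schreier–Witt symbol [[b], b)_{p^n} vanishes.) -/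
noncomputable section

namespace TruncatedWittVector

variable {p n : ℕ} [hp : Fact p.Prime] {R : Type*} [CommRing R]

/-- Frobenius on truncated Witt vectors (in characteristic `p` it raises each
coefficient to the `p`-th power). -/
def frob (x : TruncatedWittVector p n R) : TruncatedWittVector p n R :=
  WittVector.truncate n (WittVector.frobenius x.out)

end TruncatedWittVector

universe v

/-- `c` is the norm of an element of the intermediate field `L`. -/
def IsNormFrom {K M : Type*} [Field K] [Field M] [Algebra K M]
    (L : IntermediateField K M) (c : K) : Prop :=
  ∃ x : L, Algebra.norm K x = c

namespace IsNormFrom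

variable {K M : Type*} [Field K] [Field M] [Algebra K M] {L : IntermediateField K M} {c d : K}

theorem mul (hc : IsNormFrom L c) (hd : IsNormFrom L d) : IsNormFrom L (c * d) := by
  obtain ⟨x, rfl⟩ := hc
  obtain ⟨y, rfl⟩ := hd
  exact ⟨x * y, map_mul _ _ _⟩

theorem zpow [FiniteDimensional K L] (hc : IsNormFrom L c) (u : ℤ) : IsNormFrom L (c ^ u) := by
  obtain ⟨x, rfl⟩ := hc
  exact ⟨x ^ u, map_zpow' _ (fun _ => Algebra.norm_inv _) _ _⟩

theorem of_isCoprime [FiniteDimensional K L] (hc : c ≠ 0) {a b : ℤ}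
    (hab : IsCoprime a b) (ha : IsNormFrom L (c ^ a)) (hb : IsNormFrom L (c ^ b)) : IsNormFrom L c := by
  obtain ⟨u, v, huv⟩ := hab
  have := (ha.zpow u).mul (hb.zpow v)
  rwa [← zpow_mul, ← zpow_mul, ← zpow_add₀ hc, mul_comm a, mul_comm b, huv, zpow_one] at this

end IsNormFrom

section CyclicCharacters

theorem exists_pow_eq_of_mem_zpowers {C : Type*} [Group C] {x y : C} (hx : IsOfFinOrder x)
    (hy : y ∈ Subgroup.zpowers x) : ∃ i < orderOf x, x ^ i = y := by
  classical
  simpa using hx.mem_zpowers_iff_mem_range_orderOf.1 hy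

variable {K M : Type*} [Field K] [Field M] [Algebra K M]

/-- The partial norm `∏_{i < q} s^i y`. -/
def partialNorm (s : Gal(M/K)) (y : M) (q : ℕ) : M :=
  ∏ i ∈ Finset.range q, (s ^ i) y

theorem partialNorm_add (s : Gal(M/K)) (y : M) (a b : ℕ) :
    partialNorm s y (a + b) = partialNorm s y a * (s ^ a) (partialNorm s y b) := by
  simp only [partialNorm, Finset.prod_range_add, map_prod, pow_add, AlgEquiv.mul_apply]

theorem partialNorm_ne_zero (s : Gal(M/K)) {y : M} (hy : y ≠ 0) (q : ℕ) :
    partialNorm s y q ≠ 0 :=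
  Finset.prod_ne_zero_iff.2 fun i _ => (map_ne_zero (s ^ i)).2 hy

theorem partialNorm_add_mul (s : Gal(M/K)) (y : M) {r : ℕ} {c : K}
    (hr : partialNorm s y r = algebraMap K M c) (a u : ℕ) :
    partialNorm s y (a + r * u) = partialNorm s y a * algebraMap K M c ^ u := by
  induction u with
  | zero => simp
  | succ u ih =>
    rw [Nat.mul_succ, ← add_assoc, partialNorm_add, ih, hr, AlgEquiv.commutes, pow_succ, mul_assoc]

theorem apply_eq_of_map_eq {C : Type*} [Group C] {χ : Gal(M/K) →* C} {L : IntermediateField K M}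
    (hL : L.fixingSubgroup = χ.ker) {σ τ : Gal(M/K)} (h : χ σ = χ τ) {y : M} (hy : y ∈ L) :
    σ y = τ y := by
  have hm : τ⁻¹ * σ ∈ L.fixingSubgroup := by
    rw [hL, MonoidHom.mem_ker, map_mul, map_inv, h, inv_mul_cancel]
  have := (L.mem_fixingSubgroup_iff _).1 hm y hy
  have h2 := congrArg τ this
  rwa [← AlgEquiv.mul_apply, mul_inv_cancel_left] at h2

theorem algebraMap_norm_eq_partialNorm [FiniteDimensional K M] [IsGalois K M]
    {C : Type*} [Group C] {χ : Gal(M/K) →* C}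
    {L : IntermediateField K M} (hL : L.fixingSubgroup = χ.ker) {s : Gal(M/K)}
    (hs : ∀ σ, χ σ ∈ Subgroup.zpowers (χ s)) (y : L) :
    algebraMap K M (Algebra.norm K y) = partialNorm s y (orderOf (χ s)) := by
  have : L.fixingSubgroup.Normal := hL ▸ inferInstance
  have : IsGalois K L := (InfiniteGalois.normal_iff_isGalois L).1 this
  have hfin : IsOfFinOrder (χ s) := χ.isOfFinOrder (isOfFinOrder_of_finite s)
  rw [IsScalarTower.algebraMap_apply K L M, Algebra.norm_eq_prod_automorphisms, map_prod,
    partialNorm]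
  symm
  have key : ∀ σ τ : Gal(M/K), AlgEquiv.restrictNormalHom L σ = AlgEquiv.restrictNormalHom L τ →
      χ σ = χ τ := by
    intro σ τ h
    have : τ⁻¹ * σ ∈ L.fixingSubgroup := by
      rw [← L.restrictNormalHom_ker, MonoidHom.mem_ker, map_mul, map_inv, h, inv_mul_cancel]
    rw [hL, MonoidHom.mem_ker, map_mul, map_inv, inv_mul_eq_one] at this
    exact this.symm
  refine Finset.prod_bij (fun i _ => AlgEquiv.restrictNormalHom L (s ^ i)) (fun _ _ => by simp)
    ?_ ?_ ?_
  · intro i hi j hj hij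
    have := key _ _ hij
    rw [map_pow, map_pow] at this
    exact pow_injOn_Iio_orderOf (by simpa using hi) (by simpa using hj) this
  · intro τ _
    obtain ⟨σ, rfl⟩ := AlgEquiv.restrictNormalHom_surjective (F := K) (K₁ := L) M τ
    obtain ⟨i, hi, h⟩ := exists_pow_eq_of_mem_zpowers hfin (hs σ)
    refine ⟨i, Finset.mem_range.2 hi, ?_⟩
    ext z
    rw [AlgEquiv.restrictNormalHom_apply, AlgEquiv.restrictNormalHom_apply]
    exact apply_eq_of_map_eq hL (by rw [map_pow, h]) z.2
  · intro i _
    exact (AlgEquiv.restrictNormalHom_apply L _ _).symm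

theorem exists_zpowers_generator {C : Type*} [Group C] [IsCyclic C] (χ : Gal(M/K) →* C) :
    ∃ s, ∀ σ, χ σ ∈ Subgroup.zpowers (χ s) := by
  obtain ⟨⟨_, s, rfl⟩, hs⟩ := IsCyclic.exists_generator (α := χ.range)
  refine ⟨s, fun σ => ?_⟩
  obtain ⟨i, hi⟩ := hs ⟨χ σ, σ, rfl⟩
  exact ⟨i, congrArg Subtype.val hi⟩

/-- The character `χ` with values in `ZMod m` lifts to a crossed homomorphism with values in the
extension of `ZMod m` by the units of `M` obtained by adjoining a formal `m`-th root of `c`;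
equivalently, the cup product of `c` with the Bockstein of `χ` is trivial. -/
def CrossedLift {m : ℕ} (χ : Gal(M/K) →* Multiplicative (ZMod m)) (c : K) : Prop :=
  ∃ (k : Gal(M/K) → ℤ) (f : Gal(M/K) → M), (∀ σ, (k σ : ZMod m) = (χ σ).toAdd) ∧
    (∀ σ, f σ ≠ 0) ∧ ∀ σ τ, ∃ e : ℤ, k σ + k τ = k (σ * τ) + m * e ∧
      f σ * σ (f τ) = f (σ * τ) * algebraMap K M c ^ e

theorem CrossedLift.mul {m : ℕ} {χ₁ χ₂ : Gal(M/K) →* Multiplicative (ZMod m)} {c : K}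
    (hc : c ≠ 0) (h₁ : CrossedLift χ₁ c) (h₂ : CrossedLift χ₂ c) :
    CrossedLift (χ₁ * χ₂) c := by
  obtain ⟨k₁, f₁, hk₁, hf₁, h₁⟩ := h₁
  obtain ⟨k₂, f₂, hk₂, hf₂, h₂⟩ := h₂
  refine ⟨k₁ + k₂, f₁ * f₂, ?_, fun σ => mul_ne_zero (hf₁ σ) (hf₂ σ), fun σ τ => ?_⟩
  · intro σ
    simp [hk₁, hk₂]
  · obtain ⟨e₁, he₁, h₁⟩ := h₁ σ τ
    obtain ⟨e₂, he₂, h₂⟩ := h₂ σ τ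
    have hc' : algebraMap K M c ≠ 0 := by simpa using hc
    refine ⟨e₁ + e₂, ?_, ?_⟩
    · simp only [Pi.add_apply]
      linear_combination he₁ + he₂
    · simp only [Pi.mul_apply, map_mul, zpow_add₀ hc']
      linear_combination f₂ σ * σ (f₂ τ) * h₁ + f₁ (σ * τ) * algebraMap K M c ^ e₁ * h₂

theorem CrossedLift.exists_of_lift {m : ℕ} {χ : Gal(M/K) →* Multiplicative (ZMod m)} {c : K}
    (hc : c ≠ 0) (h : CrossedLift χ c) (k : Gal(M/K) → ℤ)
    (hk : ∀ σ, (k σ : ZMod m) = (χ σ).toAdd) :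
    ∃ f : Gal(M/K) → M, (∀ σ, f σ ≠ 0) ∧ ∀ σ τ, ∃ e : ℤ, k σ + k τ = k (σ * τ) + m * e ∧
      f σ * σ (f τ) = f (σ * τ) * algebraMap K M c ^ e := by
  obtain ⟨k', f, hk', hf, h⟩ := h
  have hc' : algebraMap K M c ≠ 0 := by simpa using hc
  have hd : ∀ σ, ∃ d : ℤ, k' σ = k σ + m * d := by
    intro σ
    have : (m : ℤ) ∣ k' σ - k σ := by
      rw [← ZMod.intCast_zmod_eq_zero_iff_dvd, Int.cast_sub, hk, hk', sub_self]
    obtain ⟨d, hd⟩ := this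
    exact ⟨d, by linear_combination hd⟩
  choose d hd using hd
  refine ⟨fun σ => f σ * algebraMap K M c ^ (-d σ),
    fun σ => mul_ne_zero (hf σ) (zpow_ne_zero _ hc'), fun σ τ => ?_⟩
  obtain ⟨e, he, hfe⟩ := h σ τ
  refine ⟨e - d σ - d τ + d (σ * τ), ?_, ?_⟩
  · have h1 := hd σ
    have h2 := hd τ
    have h3 := hd (σ * τ)
    linear_combination he - h1 - h2 + h3
  · have : (e - d σ - d τ + d (σ * τ)) + -d (σ * τ) = e + -d σ + -d τ := by ring
    simp only [map_mul, map_zpow₀, AlgEquiv.commutes]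
    rw [mul_assoc (f (σ * τ)), ← zpow_add₀ hc', add_comm (-d (σ * τ)), this, zpow_add₀ hc',
      zpow_add₀ hc']
    linear_combination algebraMap K M c ^ (-d σ) * algebraMap K M c ^ (-d τ) * hfe

theorem CrossedLift.of_isNormFrom [FiniteDimensional K M] [IsGalois K M]
    {m : ℕ} [NeZero m] {χ : Gal(M/K) →* Multiplicative (ZMod m)}
    {L : IntermediateField K M} (hL : L.fixingSubgroup = χ.ker) {c : K} (hc : c ≠ 0)
    (h : IsNormFrom L c) : CrossedLift χ c := by
  obtain ⟨y, hy⟩ := h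
  obtain ⟨s, hs⟩ := exists_zpowers_generator χ
  have hfin : IsOfFinOrder (χ s) := χ.isOfFinOrder (isOfFinOrder_of_finite s)
  have hN := algebraMap_norm_eq_partialNorm hL hs y
  rw [hy] at hN
  have hy0 : (y : M) ≠ 0 := by
    rintro h0
    have : y = 0 := by exact_mod_cast h0
    rw [this, Algebra.norm_zero] at hy
    exact hc hy.symm
  have hi : ∀ σ, ∃ i < orderOf (χ s), χ s ^ i = χ σ := fun σ =>
    exists_pow_eq_of_mem_zpowers hfin (hs σ)
  choose i hi hχ using hi
  have hmw : ∃ w : ℕ, orderOf (χ s) * (χ s).toAdd.val = m * w := by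
    have : (((orderOf (χ s) * (χ s).toAdd.val : ℕ) : ZMod m)) = 0 := by
      have h1 := congrArg Multiplicative.toAdd (pow_orderOf_eq_one (χ s))
      rw [toAdd_pow, toAdd_one, nsmul_eq_mul] at h1
      rwa [Nat.cast_mul, ZMod.natCast_zmod_val]
    exact (ZMod.natCast_eq_zero_iff _ _).1 this
  obtain ⟨w, hw⟩ := hmw
  refine ⟨fun σ => i σ * (χ s).toAdd.val, fun σ => partialNorm s y (i σ) ^ w, ?_,
    fun σ => pow_ne_zero _ (partialNorm_ne_zero s hy0 _), fun σ τ => ?_⟩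
  · intro σ
    rw [← hχ σ]
    simp
  · have hu : ∃ u, i σ + i τ = i (σ * τ) + orderOf (χ s) * u := by
      have h1 : χ s ^ (i σ + i τ) = χ s ^ i (σ * τ) := by
        rw [pow_add, hχ, hχ, hχ, map_mul]
      have h2 := pow_inj_mod.1 h1
      rw [Nat.mod_eq_of_lt (hi _)] at h2
      exact ⟨(i σ + i τ) / orderOf (χ s), by rw [← h2, Nat.mod_add_div]⟩
    obtain ⟨u, hu⟩ := hu
    refine ⟨(u * w : ℕ), ?_, ?_⟩
    · have h1 : ((i σ : ℤ) + i τ) = i (σ * τ) + orderOf (χ s) * u := by exact_mod_cast hu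
      have h2 : (orderOf (χ s) : ℤ) * (χ s).toAdd.val = m * w := by exact_mod_cast hw
      push_cast
      linear_combination ((χ s).toAdd.val : ℤ) * h1 + (u : ℤ) * h2
    · have hmem : partialNorm s y (i τ) ∈ L := by
        refine prod_mem fun j _ => ?_
        have : L.fixingSubgroup.Normal := hL ▸ inferInstance
        have : IsGalois K L := (InfiniteGalois.normal_iff_isGalois L).1 this
        rw [← AlgEquiv.restrictNormalHom_apply L]
        exact SetLike.coe_mem _
      rw [map_pow, ← mul_pow,
        apply_eq_of_map_eq hL (show χ σ = χ (s ^ i σ) by rw [map_pow, hχ]) hmem,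
        ← partialNorm_add, hu, partialNorm_add_mul s _ hN.symm, zpow_natCast, mul_pow, ← pow_mul]

theorem isCoprime_orderOf {m : ℕ} [NeZero m] (x : ZMod m) {E : ℤ}
    (h : (addOrderOf x : ℤ) * x.val = m * E) : IsCoprime E (addOrderOf x : ℤ) := by
  have hm : m ≠ 0 := NeZero.ne m
  have h1 : addOrderOf x = m / m.gcd x.val := by
    conv_lhs => rw [← ZMod.natCast_zmod_val x]
    exact ZMod.addOrderOf_coe _ hm
  have hg : 0 < m.gcd x.val := Nat.gcd_pos_of_pos_left _ (Nat.pos_of_ne_zero hm)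
  obtain ⟨a, ha⟩ := Nat.gcd_dvd_right m x.val
  have h2 : m.gcd x.val * addOrderOf x = m := by
    rw [h1]; exact Nat.mul_div_cancel' (Nat.gcd_dvd_left _ _)
  have hr : addOrderOf x ≠ 0 := by rintro h0; rw [h0] at h2; simp at h2; exact hm h2.symm
  have hE : E = a := by
    have h3 : (m : ℤ) * a = m * E := by
      rw [← h]
      have h4 : (x.val : ℤ) = m.gcd x.val * a := by exact_mod_cast ha
      have h5 : (m.gcd x.val : ℤ) * addOrderOf x = m := by exact_mod_cast h2
      rw [h4, ← h5]
      ring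
    exact (mul_left_cancel₀ (by exact_mod_cast hm) h3).symm
  have h6 := Nat.coprime_div_gcd_div_gcd hg
  rw [← h1, Nat.div_eq_of_eq_mul_right hg ha] at h6
  rw [hE]
  exact (Nat.isCoprime_iff_coprime.2 h6).symm

theorem CrossedLift.isNormFrom [FiniteDimensional K M] [IsGalois K M]
    {m : ℕ} [NeZero m] {χ : Gal(M/K) →* Multiplicative (ZMod m)}
    {L : IntermediateField K M} (hL : L.fixingSubgroup = χ.ker) {c : K} (hc : c ≠ 0)
    (h : CrossedLift χ c) : IsNormFrom L c := by
  obtain ⟨f, hf, hfe⟩ := h.exists_of_lift hc (fun σ => (χ σ).toAdd.val) (by simp)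
  have hleft : ∀ σ ∈ L.fixingSubgroup, ∀ τ, f σ * σ (f τ) = f (σ * τ) := by
    intro σ hσ τ
    rw [hL, MonoidHom.mem_ker] at hσ
    obtain ⟨e, he, h⟩ := hfe σ τ
    have : e = 0 := by simpa [hσ, NeZero.ne m] using he
    simpa [this] using h
  have hright : ∀ σ, ∀ τ ∈ L.fixingSubgroup, f σ * σ (f τ) = f (σ * τ) := by
    intro σ τ hτ
    rw [hL, MonoidHom.mem_ker] at hτ
    obtain ⟨e, he, h⟩ := hfe σ τ
    have : e = 0 := by simpa [hτ, NeZero.ne m] using he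
    simpa [this] using h
  let F : Gal(M/L) → Mˣ := fun g => Units.mk0 _ (hf (L.fixingSubgroupEquiv.symm g : Gal(M/K)))
  have hF : groupCohomology.IsMulCocycle₁ F := by
    intro g h
    ext
    have := hleft _ (L.fixingSubgroupEquiv.symm g).2 (L.fixingSubgroupEquiv.symm h : Gal(M/K))
    simp only [F, Units.val_mk0, map_mul, Subgroup.coe_mul, Units.val_mul,
      AlgEquiv.smul_units_def, Units.coe_map, ← this]
    rw [mul_comm]
    rfl
  obtain ⟨z, hz⟩ := groupCohomology.isMulCoboundary₁_of_isMulCocycle₁_of_aut_to_units F hF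
  have hz : ∀ σ ∈ L.fixingSubgroup, σ z = f σ * z := by
    intro σ hσ
    have := congrArg Units.val (hz (L.fixingSubgroupEquiv ⟨σ, hσ⟩))
    simp only [F, Units.val_mk0, MulEquiv.symm_apply_apply, AlgEquiv.smul_units_def,
      Units.val_div_eq_div_val, Units.coe_map] at this
    rw [← this, div_mul_cancel₀ _ z.ne_zero]
    rfl
  have hz0 : ∀ σ : Gal(M/K), σ z ≠ 0 := fun σ => by simp
  let f' : Gal(M/K) → M := fun σ => f σ * z / σ z
  have hf'0 : ∀ σ, f' σ ≠ 0 := fun σ => div_ne_zero (mul_ne_zero (hf σ) z.ne_zero) (hz0 σ)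
  have hf'1 : ∀ σ ∈ L.fixingSubgroup, f' σ = 1 := fun σ hσ => by
    simp only [f', ← hz σ hσ, div_self (hz0 σ)]
  have hf'e : ∀ σ τ, ∀ x : M, f σ * σ (f τ) = f (σ * τ) * x → f' σ * σ (f' τ) = f' (σ * τ) * x := by
    intro σ τ x h
    have h1 := hz0 σ
    have h2 := hz0 (σ * τ)
    rw [AlgEquiv.mul_apply] at h2
    simp only [f', map_div₀, map_mul, AlgEquiv.mul_apply]
    field_simp
    linear_combination h
  have hnormal : L.fixingSubgroup.Normal := hL ▸ inferInstance
  have hmem : ∀ σ, f' σ ∈ L := by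
    intro σ
    rw [← IsGalois.fixedField_fixingSubgroup L, IntermediateField.mem_fixedField_iff]
    intro τ hτ
    have h1 := hf'e τ σ 1 (by rw [mul_one]; exact hleft τ hτ σ)
    have hτ' : σ⁻¹ * τ * σ ∈ L.fixingSubgroup := by
      simpa using hnormal.conj_mem τ hτ σ⁻¹
    have h2 := hf'e σ (σ⁻¹ * τ * σ) 1 (by rw [mul_one]; exact hright σ _ hτ')
    rw [hf'1 _ hτ, one_mul, mul_one] at h1
    rw [hf'1 _ hτ', map_one, mul_one, mul_one] at h2
    rw [h1, h2]
    congr 1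
    group
  obtain ⟨s, hs⟩ := exists_zpowers_generator χ
  have hE : ∀ q : ℕ, ∃ E : ℤ, (q : ℤ) * (χ s).toAdd.val = (χ (s ^ q)).toAdd.val + m * E ∧
      partialNorm s (f' s) q = f' (s ^ q) * algebraMap K M c ^ E := by
    intro q
    have hc' : algebraMap K M c ≠ 0 := by simpa using hc
    induction q with
    | zero => exact ⟨0, by simp, by simp [partialNorm, hf'1 1 (one_mem _)]⟩
    | succ q ih =>
      obtain ⟨E, hE, h⟩ := ih
      obtain ⟨e, he, hfe⟩ := hfe (s ^ q) s
      refine ⟨E + e, ?_, ?_⟩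
      · rw [pow_succ]
        push_cast
        linear_combination hE + he
      · have h1 := hf'e _ _ _ hfe
        rw [partialNorm_add, h, zpow_add₀ hc', pow_succ]
        simp only [partialNorm, Finset.prod_range_one, pow_zero, AlgEquiv.one_apply]
        linear_combination algebraMap K M c ^ E * h1
  obtain ⟨E, hE, hP⟩ := hE (orderOf (χ s))
  have hker : s ^ orderOf (χ s) ∈ L.fixingSubgroup := by
    rw [hL, MonoidHom.mem_ker, map_pow, pow_orderOf_eq_one]
  have hN := algebraMap_norm_eq_partialNorm hL hs ⟨f' s, hmem s⟩
  rw [hP, hf'1 _ hker, one_mul, ← map_zpow₀] at hN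
  have hN := (algebraMap K M).injective hN
  have hN2 := algebraMap_norm_eq_partialNorm hL hs (algebraMap K L c)
  have hr : partialNorm s (algebraMap K L c : L) (orderOf (χ s)) =
      algebraMap K M (c ^ orderOf (χ s)) := by
    simp [partialNorm]
  rw [hr] at hN2
  have hN2 := (algebraMap K M).injective hN2
  rw [hL, MonoidHom.mem_ker] at hker
  rw [hker] at hE
  obtain ⟨u, v, huv⟩ := isCoprime_orderOf (χ s).toAdd (E := E) (by
    rw [← orderOf_ofAdd_eq_addOrderOf]; simpa using hE)
  rw [← orderOf_ofAdd_eq_addOrderOf] at huv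
  refine IsNormFrom.of_isCoprime hc ⟨u, v, huv⟩ ⟨_, hN⟩ ⟨algebraMap K L c, ?_⟩
  rw [hN2, zpow_natCast]
  rfl

/-- If `c` is a norm from the cyclic extensions cut out by two characters of order dividing `m`,
then it is a norm from the extension cut out by their product. -/
theorem isNormFrom_of_mul [FiniteDimensional K M] [IsGalois K M]
    {m : ℕ} [NeZero m] {χ₁ χ₂ : Gal(M/K) →* Multiplicative (ZMod m)}
    {L₁ L₂ L : IntermediateField K M} (hL₁ : L₁.fixingSubgroup = χ₁.ker)
    (hL₂ : L₂.fixingSubgroup = χ₂.ker) (hL : L.fixingSubgroup = (χ₁ * χ₂).ker) {c : K}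
    (hc : c ≠ 0) (h₁ : IsNormFrom L₁ c) (h₂ : IsNormFrom L₂ c) : IsNormFrom L c :=
  ((CrossedLift.of_isNormFrom hL₁ hc h₁).mul hc (CrossedLift.of_isNormFrom hL₂ hc h₂)).isNormFrom
    hL hc

end CyclicCharacters

section Witt

namespace WittVector

variable {p : ℕ} [hp : Fact p.Prime] {R S : Type*} [CommRing R] [CommRing S]

theorem truncate_eq_iff {n : ℕ} {x y : WittVector p R} :
    truncate n x = truncate n y ↔ ∀ i < n, x.coeff i = y.coeff i := by
  refine ⟨fun h i hi => ?_, fun h => TruncatedWittVector.ext fun i => ?_⟩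
  · simpa using congrArg (TruncatedWittVector.coeff (⟨i, hi⟩ : Fin n)) h
  · simpa using h i i.2

theorem truncate_map_eq {n : ℕ} {x y : WittVector p R} (f : R →+* S)
    (h : truncate n x = truncate n y) : truncate n (map f x) = truncate n (map f y) := by
  rw [truncate_eq_iff] at h ⊢
  intro i hi
  rw [map_coeff, map_coeff, h i hi]

theorem truncate_map_eq_iff {n : ℕ} {x y : WittVector p R} {f : R →+* S}
    (hf : Function.Injective f) :
    truncate n (map f x) = truncate n (map f y) ↔ truncate n x = truncate n y := by
  simp only [truncate_eq_iff, map_coeff, hf.eq_iff]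

theorem map_map {T : Type*} [CommRing T] (g : S →+* T) (f : R →+* S) (x : WittVector p R) :
    map g (map f x) = map (g.comp f) x := by
  ext
  simp

theorem map_frobenius_comm (f : R →+* S) [CharP R p] [CharP S p] (x : WittVector p R) :
    map f (frobenius x) = frobenius (map f x) := by
  ext
  simp [coeff_frobenius_charP]

theorem truncate_frobenius_eq [CharP R p] {n : ℕ} {x y : WittVector p R}
    (h : truncate n x = truncate n y) : truncate n (frobenius x) = truncate n (frobenius y) := by
  rw [frobenius_eq_map_frobenius]
  exact truncate_map_eq _ h

theorem truncate_succ_verschiebung {n : ℕ} {x y : WittVector p R} :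
    truncate (n + 1) (verschiebung x) = truncate (n + 1) (verschiebung y) ↔
      truncate n x = truncate n y := by
  simp only [truncate_eq_iff]
  refine ⟨fun h i hi => by simpa using h (i + 1) (by lia), fun h i hi => ?_⟩
  cases i with
  | zero => simp
  | succ i => simpa using h i (by lia)

theorem truncate_of_le {m n : ℕ} (hmn : m ≤ n) {x y : WittVector p R}
    (h : truncate n x = truncate n y) : truncate m x = truncate m y := by
  rw [truncate_eq_iff] at h ⊢
  exact fun i hi => h i (by lia)

theorem truncate_verschiebung {n : ℕ} {x y : WittVector p R}
    (h : truncate n x = truncate n y) :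
    truncate n (verschiebung x) = truncate n (verschiebung y) :=
  truncate_of_le n.le_succ (truncate_succ_verschiebung.2 h)

end WittVector

open WittVector

namespace TruncatedWittVector

variable {p : ℕ} [hp : Fact p.Prime]

instance charP_pow (n : ℕ) (R : Type*) [CommRing R] [CharP R p] [Nontrivial R] :
    CharP (TruncatedWittVector p n R) (p ^ n) := by
  have := charP_zmod p n
  refine ⟨fun k => ?_⟩
  rw [← CharP.cast_eq_zero_iff (TruncatedWittVector p n (ZMod p)) (p ^ n) k]
  have h1 : (k : TruncatedWittVector p n R) = 0 ↔
      WittVector.truncate n (k : WittVector p R) = WittVector.truncate n 0 := by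
    rw [map_natCast, map_zero]
  have h2 : (k : TruncatedWittVector p n (ZMod p)) = 0 ↔
      WittVector.truncate n (k : WittVector p (ZMod p)) = WittVector.truncate n 0 := by
    rw [map_natCast, map_zero]
  have h3 := truncate_map_eq_iff (n := n) (x := (k : WittVector p (ZMod p))) (y := 0)
    (ZMod.castHom dvd_rfl R).injective
  rw [map_natCast, map_zero] at h3
  exact h1.trans (h3.trans h2.symm)

end TruncatedWittVector

namespace WittVector

variable {p : ℕ} [hp : Fact p.Prime]

theorem exists_natCast_of_frobenius_eq {n : ℕ} {F : Type*} [Field F] [CharP F p]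
    {x : WittVector p F} (h : truncate n (frobenius x) = truncate n x) :
    ∃ k : ℕ, truncate n x = k := by
  rw [truncate_eq_iff] at h
  have hc : ∀ i, ∃ a : ZMod p, i < n → ZMod.castHom dvd_rfl F a = x.coeff i := by
    intro i
    by_cases hi : i < n
    · have := h i hi
      rw [coeff_frobenius_charP, ← Subfield.mem_bot_iff_pow_eq_self,
        ← ZMod.fieldRange_castHom_eq_bot p] at this
      obtain ⟨a, ha⟩ := this
      exact ⟨a, fun _ => ha⟩
    · exact ⟨0, fun h => absurd h hi⟩
  choose a ha using hc
  obtain ⟨k, hk⟩ := (TruncatedWittVector.zmodEquivTrunc p n).surjective (truncate n (mk p a))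
  refine ⟨k.val, ?_⟩
  have h1 : truncate n (mk p a) = truncate n (k.val : WittVector p (ZMod p)) := by
    rw [← hk, map_natCast, ← map_natCast (TruncatedWittVector.zmodEquivTrunc p n),
      ZMod.natCast_zmod_val]
  have h2 := truncate_map_eq (ZMod.castHom dvd_rfl F) h1
  rw [map_natCast, map_natCast] at h2
  rw [← h2, truncate_eq_iff]
  intro i hi
  rw [map_coeff, coeff_mk, ha i hi]

theorem iterate_verschiebung_frobenius_comm {R : Type*} [CommRing R] [CharP R p] (i : ℕ)
    (x : WittVector p R) : frobenius (verschiebung^[i] x) = verschiebung^[i] (frobenius x) :=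
  (Function.Commute.iterate_left
    (verschiebung_frobenius_comm (p := p) (R := R) : Function.Commute _ _) i x).symm

theorem iterate_verschiebung_add {R : Type*} [CommRing R] (i : ℕ) (x y : WittVector p R) :
    verschiebung^[i] (x + y) = verschiebung^[i] x + verschiebung^[i] y :=
  iterate_map_add _ i x y

/-- Over a separably closed field, `F - 1` is surjective on truncated Witt vectors. -/
theorem exists_truncate_frobenius_sub_eq {F : Type*} [Field F] [IsSepClosed F] [CharP F p]
    (γ : WittVector p F) (n : ℕ) : ∃ α, truncate n (frobenius α - α) = truncate n γ := by
  induction n with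
  | zero => exact ⟨0, truncate_eq_iff.2 fun i hi => absurd hi (by lia)⟩
  | succ n ih =>
    obtain ⟨α, hα⟩ := ih
    have h0 : ∀ i < n, (frobenius α - α - γ).coeff i = 0 := by
      rw [← sub_eq_zero, ← map_sub, ← map_zero (truncate n), truncate_eq_iff] at hα
      simpa using hα
    obtain ⟨δ, hδ⟩ : ∃ δ, frobenius α - α - γ = verschiebung^[n] δ :=
      ⟨_, eq_iterate_verschiebung h0⟩
    obtain ⟨x, hx⟩ : ∃ x : F, x ^ p - x + δ.coeff 0 = 0 := by
      obtain ⟨x, hx⟩ := IsSepClosed.exists_root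
        (Polynomial.X ^ p - Polynomial.X + Polynomial.C (δ.coeff 0)) (by
          have h1 : (Polynomial.X ^ p - Polynomial.X : Polynomial F).natDegree = p :=
            FiniteField.X_pow_card_sub_X_natDegree_eq F hp.out.one_lt
          have h2 := Polynomial.natDegree_add_C (p := (Polynomial.X ^ p - Polynomial.X :
            Polynomial F)) (a := δ.coeff 0)
          intro h
          rw [h1, Polynomial.natDegree_eq_of_degree_eq_some h] at h2
          exact hp.out.ne_zero h2.symm) (by
          rw [Polynomial.separable_def]
          simp [Polynomial.derivative_X_pow, isCoprime_one_right.neg_right])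
      exact ⟨x, by simpa using hx⟩
    refine ⟨α + verschiebung^[n] (teichmuller p x), ?_⟩
    rw [← sub_eq_zero, ← map_sub, ← map_zero (truncate (n + 1)), truncate_eq_iff]
    have : frobenius (α + verschiebung^[n] (teichmuller p x)) -
        (α + verschiebung^[n] (teichmuller p x)) - γ =
        verschiebung^[n] (δ + (frobenius (teichmuller p x) - teichmuller p x)) := by
      rw [iterate_verschiebung_add, iterate_map_sub, ← hδ, map_add,
        iterate_verschiebung_frobenius_comm]
      ring
    rw [this]
    intro i hi
    rw [zero_coeff]
    rcases Nat.lt_succ_iff_lt_or_eq.1 hi with hi | rfl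
    · exact iterate_verschiebung_coeff_eq_zero _ hi
    · have h1 := iterate_verschiebung_coeff
        (δ + (frobenius (teichmuller p x) - teichmuller p x)) i 0
      rw [zero_add] at h1
      rw [h1]
      change constantCoeff (δ + (frobenius (teichmuller p x) - teichmuller p x)) = 0
      rw [map_add, map_sub]
      change δ.coeff 0 + ((frobenius (teichmuller p x)).coeff 0 - (teichmuller p x).coeff 0) = 0
      rw [coeff_frobenius_charP, teichmuller_coeff_zero]
      linear_combination hx

end WittVector

end Witt

section ArtinSchreierWitt

namespace WittVector

variable {p : ℕ} [hp : Fact p.Prime] {K M : Type*} [Field K] [Field M] [Algebra K M]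

/-- The intermediate field generated by the first `n` coefficients of a Witt vector. -/
def coeffField (K : Type*) {M : Type*} [Field K] [Field M] [Algebra K M] (n : ℕ)
    (α : WittVector p M) : IntermediateField K M :=
  IntermediateField.adjoin K {x | ∃ i < n, α.coeff i = x}

theorem coeffField_le_iff {n : ℕ} {α : WittVector p M} {L : IntermediateField K M} :
    coeffField K n α ≤ L ↔ ∀ i < n, α.coeff i ∈ L := by
  rw [coeffField, IntermediateField.adjoin_le_iff]
  exact ⟨fun h i hi => h ⟨i, hi, rfl⟩, fun h x ⟨i, hi, hx⟩ => hx ▸ h i hi⟩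

theorem coeff_mem_coeffField {n i : ℕ} (α : WittVector p M) (hi : i < n) :
    α.coeff i ∈ coeffField K n α :=
  coeffField_le_iff.1 le_rfl i hi

theorem coeffField_le_iff_exists {n : ℕ} {α : WittVector p M} {L : IntermediateField K M} :
    coeffField K n α ≤ L ↔
      ∃ a : WittVector p L, truncate n (map (algebraMap L M) a) = truncate n α := by
  classical
  rw [coeffField_le_iff]
  constructor
  · intro h
    refine ⟨mk p fun i => if hi : α.coeff i ∈ L then ⟨α.coeff i, hi⟩ else 0,
      truncate_eq_iff.2 fun i hi => ?_⟩
    simp [h i hi]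
  · rintro ⟨a, ha⟩ i hi
    rw [← truncate_eq_iff.1 ha i hi, map_coeff]
    exact (a.coeff i).2

theorem coeffField_congr {n : ℕ} {α β : WittVector p M} (h : truncate n α = truncate n β) :
    coeffField K n α = coeffField K n β :=
  eq_of_forall_ge_iff fun L => by rw [coeffField_le_iff_exists, coeffField_le_iff_exists, h]

theorem coeffField_add_le (n : ℕ) (α β : WittVector p M) :
    coeffField K n (α + β) ≤ coeffField K n α ⊔ coeffField K n β := by
  obtain ⟨a, ha⟩ := coeffField_le_iff_exists.1
    (le_sup_left : coeffField K n α ≤ coeffField K n α ⊔ coeffField K n β)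
  obtain ⟨b, hb⟩ := coeffField_le_iff_exists.1
    (le_sup_right : coeffField K n β ≤ coeffField K n α ⊔ coeffField K n β)
  exact coeffField_le_iff_exists.2 ⟨a + b, by simp only [map_add, ha, hb]⟩

theorem coeffField_map_algebraMap (n : ℕ) (γ : WittVector p K) :
    coeffField K n (map (algebraMap K M) γ) = ⊥ :=
  le_bot_iff.1 <| coeffField_le_iff.2 fun i _ => by
    rw [map_coeff]
    exact IntermediateField.algebraMap_mem _ _

theorem coeffField_add_map_algebraMap (n : ℕ) (α : WittVector p M) (γ : WittVector p K) :
    coeffField K n (α + map (algebraMap K M) γ) = coeffField K n α := by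
  refine le_antisymm ?_ ?_
  · simpa [coeffField_map_algebraMap] using
      coeffField_add_le (K := K) n α (map (algebraMap K M) γ)
  · have := coeffField_add_le (K := K) n (α + map (algebraMap K M) γ)
      (map (algebraMap K M) (-γ))
    rw [coeffField_map_algebraMap, sup_bot_eq] at this
    simpa using this

theorem coeffField_eq_of_truncate_eq_add_natCast {n k : ℕ} {α β : WittVector p M}
    (h : truncate n β = truncate n α + k) : coeffField K n β = coeffField K n α := by
  rw [← coeffField_add_map_algebraMap n α (k : WittVector p K)]
  exact coeffField_congr (by rw [h]; simp)

theorem coeffField_map {E : Type*} [Field E] [Algebra K E] (n : ℕ) (f : E →ₐ[K] M)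
    (α : WittVector p E) :
    coeffField K n (map (f : E →+* M) α) = (coeffField K n α).map f := by
  rw [coeffField, coeffField, IntermediateField.adjoin_map]
  congr 1
  ext x
  simp only [Set.mem_ofPred_eq, Set.mem_image, map_coeff]
  exact ⟨fun ⟨i, hi, hx⟩ => ⟨_, ⟨i, hi, rfl⟩, hx⟩, fun ⟨_, ⟨i, hi, hy⟩, hx⟩ =>
    ⟨i, hi, by rw [hy]; exact hx⟩⟩

instance finiteDimensional_coeffField [Algebra.IsIntegral K M] (n : ℕ) (α : WittVector p M) :
    FiniteDimensional K (coeffField K n α) := by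
  have : Finite {x | ∃ i < n, α.coeff i = x} := (Set.finite_lt_nat n).image α.coeff
  exact IntermediateField.finiteDimensional_adjoin fun x _ => Algebra.IsIntegral.isIntegral x

/-- `α` solves the Artin–Schreier–Witt equation `F α - α = γ` in Witt vectors of length `n`. -/
def IsASWRoot (n : ℕ) (γ : WittVector p K) (α : WittVector p M) : Prop :=
  truncate n (frobenius α - α) = truncate n (map (algebraMap K M) γ)

namespace IsASWRoot

variable {n : ℕ} {γ γ' : WittVector p K} {α β : WittVector p M}

theorem add (hα : IsASWRoot n γ α) (hβ : IsASWRoot n γ' β) : IsASWRoot n (γ + γ') (α + β) := by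
  unfold IsASWRoot at *
  have h : frobenius (α + β) - (α + β) = frobenius α - α + (frobenius β - β) := by
    rw [map_add]
    ring
  rw [h, (truncate n).map_add, hα, hβ, ← map_add, ← map_add]

theorem sub (hα : IsASWRoot n γ α) (hβ : IsASWRoot n γ' β) : IsASWRoot n (γ - γ') (α - β) := by
  unfold IsASWRoot at *
  have h : frobenius (α - β) - (α - β) = frobenius α - α - (frobenius β - β) := by
    rw [map_sub]
    ring
  rw [h, _root_.map_sub (truncate n), hα, hβ, ← map_sub, ← map_sub]

variable [CharP M p]

theorem congr (hα : IsASWRoot n γ α) (hγ : truncate n γ = truncate n γ')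
    (h : truncate n α = truncate n β) : IsASWRoot n γ' β := by
  unfold IsASWRoot at *
  rw [← truncate_map_eq _ hγ, ← hα, map_sub, map_sub, h, truncate_frobenius_eq h]

theorem map_iff {E : Type*} [Field E] [Algebra K E] [CharP E p] (f : M →ₐ[K] E) :
    IsASWRoot n γ (map (f : M →+* E) α) ↔ IsASWRoot n γ α := by
  unfold IsASWRoot
  rw [← map_frobenius_comm, ← map_sub, ← f.comp_algebraMap, ← map_map]
  exact truncate_map_eq_iff f.injective

theorem exists_eq_add_natCast (hα : IsASWRoot n γ α) (hβ : IsASWRoot n γ β) :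
    ∃ k : ℕ, truncate n β = truncate n α + k := by
  obtain ⟨k, hk⟩ := exists_natCast_of_frobenius_eq (n := n) (x := β - α) (by
    have := hβ.sub hα
    rw [sub_self] at this
    unfold IsASWRoot at this
    rwa [map_sub, map_zero, map_zero, sub_eq_zero] at this)
  exact ⟨k, by rw [← hk, map_sub]; ring⟩

theorem coeffField_eq (hα : IsASWRoot n γ α) (hβ : IsASWRoot n γ β) :
    coeffField K n β = coeffField K n α :=
  have ⟨_, hk⟩ := hα.exists_eq_add_natCast hβ
  coeffField_eq_of_truncate_eq_add_natCast hk

theorem exists_root [IsSepClosed M] (n : ℕ) (γ : WittVector p K) :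
    ∃ α : WittVector p M, IsASWRoot n γ α :=
  exists_truncate_frobenius_sub_eq _ _

theorem map_algebraMap [CharP K p] (n : ℕ) (γ : WittVector p K) :
    IsASWRoot n (frobenius γ - γ) (map (algebraMap K M) γ) := by
  unfold IsASWRoot
  rw [_root_.map_sub (map (algebraMap K M)), map_frobenius_comm]

theorem isGalois_coeffField [IsAlgClosed M] [Algebra.IsAlgebraic K M] (hα : IsASWRoot n γ α) :
    IsGalois K (coeffField K n α) := by
  have : Normal K M := (IsAlgClosure.mk inferInstance inferInstance : IsAlgClosure K M).normal
  have h1 : Normal K (coeffField K n α) := by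
    rw [IntermediateField.normal_iff_forall_map_le]
    intro σ
    rw [← coeffField_map]
    exact (hα.coeffField_eq ((map_iff σ).2 hα)).le
  have h2 : coeffField K n α ≤ separableClosure K M := by
    have : IsSepClosed (separableClosure K M) :=
      (separableClosure.isSepClosure K M).sep_closed
    have : CharP (separableClosure K M) p :=
      (algebraMap (separableClosure K M) M).charP (algebraMap (separableClosure K M) M).injective p
    obtain ⟨β, hβ⟩ := exists_root (M := separableClosure K M) n γ
    rw [← ((map_iff (separableClosure K M).val).2 hβ).coeffField_eq hα |>.symm]
    exact coeffField_le_iff_exists.2 ⟨β, rfl⟩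
  have h3 : Algebra.IsSeparable K (coeffField K n α) :=
    le_separableClosure_iff K M _ |>.1 h2
  exact ⟨⟩

end IsASWRoot

variable [CharP M p]

/-- `χ` describes the Galois action on the first `n` coefficients of `α`. -/
def IsASWCharacter (n : ℕ) (α : WittVector p M)
    (χ : Gal(M/K) →* Multiplicative (ZMod (p ^ n))) : Prop :=
  ∀ σ : Gal(M/K), truncate n (map (σ : M →+* M) α) =
    truncate n α + ZMod.castHom dvd_rfl (TruncatedWittVector p n M) (χ σ).toAdd

theorem IsASWCharacter.mul {n : ℕ} {α β : WittVector p M}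
    {χ ψ : Gal(M/K) →* Multiplicative (ZMod (p ^ n))} (hα : IsASWCharacter n α χ)
    (hβ : IsASWCharacter n β ψ) : IsASWCharacter n (α + β) (χ * ψ) := by
  intro σ
  rw [map_add, map_add, hα, hβ, MonoidHom.mul_apply, toAdd_mul, map_add, map_add]
  ring

theorem IsASWCharacter.fixingSubgroup_eq {n : ℕ} {α : WittVector p M}
    {χ : Gal(M/K) →* Multiplicative (ZMod (p ^ n))} (hα : IsASWCharacter n α χ) :
    (coeffField K n α).fixingSubgroup = χ.ker := by
  ext σ
  have h1 : σ ∈ χ.ker ↔ truncate n (map (σ : M →+* M) α) = truncate n α := by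
    rw [hα σ, add_eq_left, _root_.map_eq_zero_iff _ (ZMod.castHom_injective _), MonoidHom.mem_ker]
    rfl
  rw [h1, truncate_eq_iff, ← Subgroup.zpowers_le, ← IntermediateField.le_iff_le,
    coeffField_le_iff]
  refine forall₂_congr fun i _ => ?_
  rw [map_coeff]
  constructor
  · intro h
    exact h ⟨σ, Subgroup.mem_zpowers σ⟩
  · intro h
    have h2 : Subgroup.zpowers σ ≤ MulAction.stabilizer Gal(M/K) (α.coeff i) :=
      Subgroup.zpowers_le.2 h
    exact fun g => h2 g.2

theorem IsASWRoot.exists_isASWCharacter {n : ℕ} {γ : WittVector p K} {α : WittVector p M}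
    (hα : IsASWRoot n γ α) :
    ∃ χ : Gal(M/K) →* Multiplicative (ZMod (p ^ n)), IsASWCharacter n α χ := by
  have hk : ∀ σ : Gal(M/K), ∃ k : ℕ, truncate n (map (σ : M →+* M) α) = truncate n α + k :=
    fun σ => hα.exists_eq_add_natCast ((map_iff (σ : M →ₐ[K] M)).2 hα)
  choose k hk using hk
  refine ⟨MonoidHom.mk' (fun σ => Multiplicative.ofAdd (k σ : ZMod (p ^ n))) ?_, ?_⟩
  · intro σ τ
    rw [← ofAdd_add]
    congr 1
    apply ZMod.castHom_injective (TruncatedWittVector p n M)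
    rw [map_add, map_natCast, map_natCast, map_natCast]
    apply add_left_cancel (a := truncate n α)
    rw [← hk, ← add_assoc, ← hk, ← map_natCast (truncate n) (k τ), ← map_add,
      ← map_natCast (map (σ : M →+* M)) (k τ), ← map_add]
    have h2 := truncate_map_eq (σ : M →+* M) (n := n) (x := map (τ : M →+* M) α)
      (y := α + k τ) (by rw [hk, map_add, map_natCast])
    rw [← h2, map_map]
    rfl
  · intro σ
    rw [hk]
    simp

end WittVector

end ArtinSchreierWitt

section NormTransfer

variable {K E M : Type*} [Field K] [Field E] [Field M] [Algebra K E] [Algebra K M]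

theorem isNormFrom_map_iff (f : E →ₐ[K] M) {L : IntermediateField K E} {c : K} :
    IsNormFrom (L.map f) c ↔ IsNormFrom L c :=
  let e : L ≃ₐ[K] L.map f := L.equivMap f
  ⟨fun ⟨x, hx⟩ => ⟨e.symm x, by rw [Algebra.norm_eq_of_algEquiv, hx]⟩,
    fun ⟨x, hx⟩ => ⟨e x, by rw [Algebra.norm_eq_of_algEquiv, hx]⟩⟩

theorem IsNormFrom.mono {L L' : IntermediateField K M} [FiniteDimensional K L'] (h : L ≤ L')
    {c : K} (hc : IsNormFrom L' c) : IsNormFrom L c := by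
  obtain ⟨x, rfl⟩ := hc
  let : Algebra L L' := (IntermediateField.inclusion h).toRingHom.toAlgebra
  have : IsScalarTower K L L' := IsScalarTower.of_algHom (IntermediateField.inclusion h)
  exact ⟨Algebra.norm L x, Algebra.norm_norm⟩

theorem IsNormFrom.norm_restrictScalars {F : IntermediateField K M} {L : IntermediateField F M}
    {c : F} (hc : IsNormFrom L c) :
    IsNormFrom (L.restrictScalars K) (Algebra.norm K c) := by
  obtain ⟨x, rfl⟩ := hc
  exact ⟨x, (Algebra.norm_norm (R := K) (S := F) (a := x)).symm⟩

theorem prod_add_zmod_cast {p : ℕ} [hp : Fact p.Prime] {F : Type*} [Field F] [CharP F p] (t : F) :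
    ∏ i : ZMod p, (t + ZMod.castHom dvd_rfl F i) = t ^ p - t := by
  have h1 : (Polynomial.X ^ p - Polynomial.X : Polynomial (ZMod p)).roots = Finset.univ.val := by
    have := FiniteField.roots_X_pow_card_sub_X (ZMod p)
    rwa [ZMod.card] at this
  have hm : (Polynomial.X ^ p - Polynomial.X : Polynomial (ZMod p)).Monic := by
    apply Polynomial.monic_X_pow_sub
    rw [Polynomial.degree_X]
    exact_mod_cast hp.out.one_lt
  have h2 := congrArg (Polynomial.eval₂ (ZMod.castHom dvd_rfl F) t)
    ((GaloisField.splits_zmod_X_pow_sub_X p).eq_prod_roots_of_monic hm)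
  rw [h1] at h2
  change _ = Polynomial.eval₂ _ _ (∏ i : ZMod p, (Polynomial.X - Polynomial.C i)) at h2
  rw [Polynomial.eval₂_finsetProd] at h2
  simp only [Polynomial.eval₂_sub, Polynomial.eval₂_pow, Polynomial.eval₂_X,
    Polynomial.eval₂_C] at h2
  rw [h2]
  exact Fintype.prod_equiv (Equiv.neg _) _ _ fun i => by simp

end NormTransfer

namespace WittVector

variable {p : ℕ} [hp : Fact p.Prime] {K Ω : Type*} [Field K] [Field Ω] [Algebra K Ω]

/-- `c` is a norm from the field obtained by adjoining the solutions of `F α - α = γ` in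
Witt vectors of length `n` over `Ω`. -/
def SymbolVanishes (Ω : Type*) [Field Ω] [Algebra K Ω] (n : ℕ) (γ : WittVector p K) (c : K) :
    Prop :=
  ∀ α : WittVector p Ω, IsASWRoot n γ α → IsNormFrom (coeffField K n α) c

theorem IsASWRoot.symbolVanishes [CharP Ω p] {n : ℕ} {γ : WittVector p K} {α : WittVector p Ω}
    (hα : IsASWRoot n γ α) {c : K} (h : IsNormFrom (coeffField K n α) c) :
    SymbolVanishes Ω n γ c :=
  fun _ hβ => (hα.coeffField_eq hβ).symm ▸ h

theorem IsASWRoot.exists_isNormFrom_pow [IsAlgClosed Ω] [Algebra.IsAlgebraic K Ω] [CharP Ω p]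
    {n : ℕ} {γ : WittVector p K} {α : WittVector p Ω} (hα : IsASWRoot n γ α) (c : K) :
    ∃ s : ℕ, IsNormFrom (coeffField K n α) (c ^ p ^ s) := by
  set L := coeffField K n α with hL
  have := hα.isGalois_coeffField
  have : CharP L p := (algebraMap L Ω).charP (algebraMap L Ω).injective p
  obtain ⟨a, ha⟩ := coeffField_le_iff_exists.1 (le_refl L)
  have haα : IsASWRoot n γ a := (IsASWRoot.map_iff L.val).1 (hα.congr rfl ha.symm)
  obtain ⟨χ, hχ⟩ := haα.exists_isASWCharacter
  have htop : coeffField K n a = ⊤ := by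
    apply IntermediateField.map_injective L.val
    rw [← coeffField_map, ← AlgHom.fieldRange_eq_map, IntermediateField.fieldRange_val]
    exact coeffField_congr ha
  have hker := hχ.fixingSubgroup_eq
  rw [htop, IntermediateField.fixingSubgroup_top] at hker
  have hdvd := Subgroup.card_dvd_of_injective χ ((MonoidHom.ker_eq_bot_iff χ).1 hker.symm)
  rw [IsGalois.card_aut_eq_finrank, Nat.card_congr Multiplicative.toAdd, Nat.card_zmod] at hdvd
  obtain ⟨s, -, hs⟩ := (Nat.dvd_prime_pow hp.out).1 hdvd
  exact ⟨s, algebraMap K L c, by rw [Algebra.norm_algebraMap, hs]⟩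

namespace SymbolVanishes

variable {n : ℕ} {γ γ' : WittVector p K} {c : K}

theorem congr (h : SymbolVanishes Ω n γ c) (hγ : truncate n γ = truncate n γ') [CharP Ω p] :
    SymbolVanishes Ω n γ' c :=
  fun α hα => h α (hα.congr hγ.symm rfl)

theorem add [IsAlgClosed Ω] [Algebra.IsAlgebraic K Ω] [CharP Ω p] (hc : c ≠ 0)
    (h : SymbolVanishes Ω n γ c) (h' : SymbolVanishes Ω n γ' c) :
    SymbolVanishes Ω n (γ + γ') c := by
  intro α hα
  obtain ⟨β, hβ⟩ := IsASWRoot.exists_root (M := Ω) n γ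
  have hβ' : IsASWRoot n γ' (α - β) := (hα.sub hβ).congr (by rw [add_sub_cancel_left]) rfl
  have := hβ.isGalois_coeffField
  have := hβ'.isGalois_coeffField
  set E := coeffField K n β ⊔ coeffField K n (α - β) with hE
  have : CharP E p := (algebraMap E Ω).charP (algebraMap E Ω).injective p
  obtain ⟨a, ha⟩ := coeffField_le_iff_exists.1 (le_sup_left.trans hE.ge)
  obtain ⟨a', ha'⟩ := coeffField_le_iff_exists.1 (le_sup_right.trans hE.ge)
  have haβ : IsASWRoot n γ a := (IsASWRoot.map_iff E.val).1 (hβ.congr rfl ha.symm)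
  have haβ' : IsASWRoot n γ' a' := (IsASWRoot.map_iff E.val).1 (hβ'.congr rfl ha'.symm)
  have hsum : truncate n (map (algebraMap E Ω) (a + a')) = truncate n α := by
    rw [map_add, map_add, ha, ha', ← map_add, add_sub_cancel]
  have key : ∀ {x : WittVector p E} {ξ : WittVector p Ω},
      truncate n (map (algebraMap E Ω) x) = truncate n ξ →
      (IsNormFrom (coeffField K n x) c ↔ IsNormFrom (coeffField K n ξ) c) := by
    intro x ξ hx
    rw [← isNormFrom_map_iff E.val, ← coeffField_map]
    exact iff_of_eq (congrArg (fun L => IsNormFrom L c) (coeffField_congr hx))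
  obtain ⟨χ, hχ⟩ := haβ.exists_isASWCharacter
  obtain ⟨χ', hχ'⟩ := haβ'.exists_isASWCharacter
  exact (key hsum).1 (isNormFrom_of_mul hχ.fixingSubgroup_eq hχ'.fixingSubgroup_eq
    (hχ.mul hχ').fixingSubgroup_eq hc ((key ha).2 (h _ hβ)) ((key ha').2 (h' _ hβ')))

theorem frobenius_sub [CharP K p] [CharP Ω p] (n : ℕ) (γ : WittVector p K) (c : K) :
    SymbolVanishes Ω n (frobenius γ - γ) c := by
  refine (IsASWRoot.map_algebraMap n γ).symbolVanishes ?_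
  rw [coeffField_map_algebraMap]
  exact ⟨algebraMap K _ c, by
    rw [Algebra.norm_algebraMap, IntermediateField.finrank_bot, pow_one]⟩

theorem zero [CharP K p] [CharP Ω p] (n : ℕ) (c : K) :
    SymbolVanishes Ω n (0 : WittVector p K) c := by
  simpa using frobenius_sub (Ω := Ω) n (0 : WittVector p K) c

theorem sum [IsAlgClosed Ω] [Algebra.IsAlgebraic K Ω] [CharP K p] [CharP Ω p] (hc : c ≠ 0)
    {ι : Type*} (s : Finset ι) (f : ι → WittVector p K)
    (h : ∀ i ∈ s, SymbolVanishes Ω n (f i) c) : SymbolVanishes Ω n (∑ i ∈ s, f i) c :=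
  Finset.sum_induction f (SymbolVanishes Ω n · c) (fun _ _ => add hc) (zero n c) h

end SymbolVanishes

end WittVector

namespace WittVector

section Monomials

variable {p : ℕ} [hp : Fact p.Prime] {K Ω : Type*} [Field K] [Field Ω] [Algebra K Ω]

theorem frobenius_teichmuller {R : Type*} [CommRing R] [CharP R p] (a : R) :
    frobenius (teichmuller p a) = teichmuller p (a ^ p) := by
  rw [frobenius_eq_map_frobenius, map_teichmuller]
  rfl

theorem truncate_iterate_verschiebung {R : Type*} [CommRing R] {n : ℕ} {x y : WittVector p R}
    (i : ℕ) (h : truncate n x = truncate n y) :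
    truncate n (verschiebung^[i] x) = truncate n (verschiebung^[i] y) := by
  induction i with
  | zero => exact h
  | succ i ih => simpa only [Function.iterate_succ_apply'] using truncate_verschiebung ih

theorem map_iterate_verschiebung {R S : Type*} [CommRing R] [CommRing S] (f : R →+* S) (i : ℕ)
    (x : WittVector p R) : map f (verschiebung^[i] x) = verschiebung^[i] (map f x) := by
  induction i with
  | zero => rfl
  | succ i ih =>
    rw [Function.iterate_succ_apply', Function.iterate_succ_apply', map_verschiebung, ih]

theorem iterate_verschiebung_sum {R ι : Type*} [CommRing R] (i : ℕ) (s : Finset ι)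
    (f : ι → WittVector p R) :
    verschiebung^[i] (∑ j ∈ s, f j) = ∑ j ∈ s, verschiebung^[i] (f j) :=
  map_sum (AddMonoidHom.mk' _ (iterate_verschiebung_add i)) f s

theorem coeffField_iterate_verschiebung_le (n i : ℕ) (α : WittVector p Ω) :
    coeffField K n (verschiebung^[i] α) ≤ coeffField K n α := by
  obtain ⟨a, ha⟩ := coeffField_le_iff_exists.1 (le_refl (coeffField K n α))
  exact coeffField_le_iff_exists.2 ⟨verschiebung^[i] a, by
    rw [map_iterate_verschiebung]
    exact truncate_iterate_verschiebung i ha⟩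

theorem IsASWRoot.iterate_verschiebung [CharP Ω p] {n : ℕ} {γ : WittVector p K}
    {α : WittVector p Ω} (hα : IsASWRoot n γ α) (i : ℕ) :
    IsASWRoot n (verschiebung^[i] γ) (verschiebung^[i] α) := by
  unfold IsASWRoot
  rw [iterate_verschiebung_frobenius_comm, ← iterate_map_sub, map_iterate_verschiebung]
  exact truncate_iterate_verschiebung i hα

variable [IsAlgClosed Ω] [Algebra.IsAlgebraic K Ω] [CharP K p] [CharP Ω p] {n : ℕ} {t : K}

theorem symbolVanishes_iterate_verschiebung_teichmuller
    (hn : ∀ b : K, b ≠ 0 → SymbolVanishes Ω n (teichmuller p b) b) (ht : t ≠ 0) {a : K}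
    (ha : a ^ p = a) (i j : ℕ) (hj : j ≠ 0) :
    SymbolVanishes Ω n (verschiebung^[i] (teichmuller p (a * t ^ j))) t := by
  induction j using Nat.strong_induction_on with
  | _ j ih =>
  by_cases ha0 : a = 0
  · rw [ha0, zero_mul, teichmuller_zero, iterate_map_zero]
    exact .zero n t
  by_cases hpj : p ∣ j
  · obtain ⟨k, rfl⟩ := hpj
    have hk : k ≠ 0 := right_ne_zero_of_mul hj
    have h1 : verschiebung^[i] (teichmuller p (a * t ^ (p * k))) =
        (frobenius (verschiebung^[i] (teichmuller p (a * t ^ k))) -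
          verschiebung^[i] (teichmuller p (a * t ^ k))) +
        verschiebung^[i] (teichmuller p (a * t ^ k)) := by
      rw [iterate_verschiebung_frobenius_comm, frobenius_teichmuller, mul_pow, ha, ← pow_mul,
        mul_comm k, sub_add_cancel]
    rw [h1]
    refine (SymbolVanishes.frobenius_sub _ _ _).add ht (ih k ?_ hk)
    exact lt_mul_of_one_lt_left (Nat.pos_of_ne_zero hk) hp.out.one_lt
  · obtain ⟨β, hβ⟩ := IsASWRoot.exists_root (M := Ω) n (teichmuller p (a * t ^ j))
    refine (hβ.iterate_verschiebung i).symbolVanishes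
      (.mono (coeffField_iterate_verschiebung_le n i β) ?_)
    obtain ⟨s, hs⟩ := hβ.exists_isNormFrom_pow t
    have h1 := (hn _ (mul_ne_zero ha0 (pow_ne_zero j ht)) β hβ).zpow ((p : ℤ) - 1)
    have h2 : (a * t ^ j) ^ ((p : ℤ) - 1) = t ^ ((j * (p - 1) : ℕ) : ℤ) := by
      have ha1 : a ^ (p - 1) = 1 := by
        apply mul_right_cancel₀ ha0
        rw [← pow_succ, Nat.sub_add_cancel hp.out.one_le, ha, one_mul]
      rw [← Nat.cast_pred hp.out.pos, zpow_natCast, zpow_natCast, mul_pow, ha1, one_mul, pow_mul]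
    rw [h2] at h1
    refine IsNormFrom.of_isCoprime ht (b := ((p ^ s : ℕ) : ℤ)) ?_ h1 (by rwa [zpow_natCast])
    rw [Nat.isCoprime_iff_coprime]
    refine Nat.Coprime.pow_right s (Nat.Coprime.mul_left ?_ ?_)
    · exact ((Nat.Prime.coprime_iff_not_dvd hp.out).2 hpj).symm
    · exact (Nat.coprime_self_sub_left hp.out.one_le).2 (Nat.coprime_one_left p)

theorem symbolVanishes_map_aeval [Algebra (ZMod p) K]
    (hn : ∀ b : K, b ≠ 0 → SymbolVanishes Ω n (teichmuller p b) b) (ht : t ≠ 0)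
    (i : ℕ) (γ : WittVector p (Polynomial (ZMod p))) (hγ : map Polynomial.constantCoeff γ = 0) :
    SymbolVanishes Ω n
      (verschiebung^[i] (map (Polynomial.aeval t : Polynomial (ZMod p) →ₐ[ZMod p] K).toRingHom γ))
      t := by
  by_cases hi : n ≤ i
  · refine (SymbolVanishes.zero n t).congr (truncate_eq_iff.2 fun k hk => ?_)
    rw [zero_coeff, iterate_verschiebung_coeff_eq_zero _ (by lia)]
  set φ := (Polynomial.aeval t : Polynomial (ZMod p) →ₐ[ZMod p] K).toRingHom with hφ
  set P := γ.coeff 0 with hP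
  have hP0 : P.coeff 0 = 0 := by
    have := congrArg (fun x => x.coeff 0) hγ
    simpa using this
  have hsum : (∑ j ∈ P.support, teichmuller p (Polynomial.C (P.coeff j) * Polynomial.X ^ j)).coeff 0
      = P := by
    change constantCoeff (∑ j ∈ P.support, _) = P
    rw [map_sum]
    conv_rhs => rw [P.as_sum_support_C_mul_X_pow]
    exact Finset.sum_congr rfl fun j _ => teichmuller_coeff_zero p _
  obtain ⟨δ, hδ⟩ : ∃ δ, γ - ∑ j ∈ P.support,
      teichmuller p (Polynomial.C (P.coeff j) * Polynomial.X ^ j) = verschiebung δ := by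
    refine ⟨_, eq_iterate_verschiebung (n := 1) fun k hk => ?_⟩
    obtain rfl : k = 0 := by lia
    change constantCoeff (γ - _) = 0
    rw [map_sub]
    exact sub_eq_zero.2 hsum.symm
  have hδ0 : map Polynomial.constantCoeff δ = 0 := by
    apply verschiebung_injective
    rw [← map_verschiebung, ← hδ, map_sub, hγ, map_sum, map_zero, zero_sub, neg_eq_zero]
    refine Finset.sum_eq_zero fun j hj => ?_
    have hj0 : j ≠ 0 := by
      rintro rfl
      exact Polynomial.mem_support_iff.1 hj hP0
    rw [map_teichmuller]
    simp [hj0.symm]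
  have hγ' : verschiebung^[i] (map φ γ) = verschiebung^[i + 1] (map φ δ) +
      ∑ j ∈ P.support,
        verschiebung^[i] (teichmuller p (algebraMap (ZMod p) K (P.coeff j) * t ^ j)) := by
    rw [eq_add_of_sub_eq hδ, map_add, map_verschiebung, iterate_verschiebung_add,
      ← Function.iterate_succ_apply, map_sum, iterate_verschiebung_sum]
    congr 1
    refine Finset.sum_congr rfl fun j _ => ?_
    rw [map_teichmuller]
    simp [hφ]
  rw [hγ']
  refine (symbolVanishes_map_aeval hn ht (i + 1) δ hδ0).add ht (.sum ht _ _ fun j hj => ?_)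
  refine symbolVanishes_iterate_verschiebung_teichmuller hn ht ?_ i j ?_
  · rw [← map_pow, ZMod.pow_card]
  · rintro rfl
    exact Polynomial.mem_support_iff.1 hj hP0
termination_by n - i

end Monomials

end WittVector

namespace WittVector

section Induction

variable {p : ℕ} [hp : Fact p.Prime]

theorem sub_coeff_zero {R : Type*} [CommRing R] (x y : WittVector p R) :
    (x - y).coeff 0 = x.coeff 0 - y.coeff 0 :=
  map_sub constantCoeff x y

theorem natCast_coeff_zero {R : Type*} [CommRing R] (k : ℕ) :
    (k : WittVector p R).coeff 0 = k :=
  map_natCast constantCoeff k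

/-- The difference `[X ^ p - X] - [X ^ p] + [X]` is a Verschiebung without constant terms. -/
theorem exists_verschiebung_eq_teichmuller_sub (p : ℕ) [hp : Fact p.Prime] :
    ∃ G : WittVector p (Polynomial (ZMod p)), map Polynomial.constantCoeff G = 0 ∧
      teichmuller p (Polynomial.X ^ p - Polynomial.X) - teichmuller p (Polynomial.X ^ p) +
        teichmuller p Polynomial.X = verschiebung G := by
  obtain ⟨G, hG⟩ : ∃ G : WittVector p (Polynomial (ZMod p)),
      teichmuller p (Polynomial.X ^ p - Polynomial.X) - teichmuller p (Polynomial.X ^ p) +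
        teichmuller p Polynomial.X = verschiebung G := by
    refine ⟨_, eq_iterate_verschiebung (n := 1) fun k hk => ?_⟩
    obtain rfl : k = 0 := by lia
    simp only [add_coeff_zero, sub_coeff_zero, teichmuller_coeff_zero]
    ring
  refine ⟨G, verschiebung_injective p _ ?_, hG⟩
  rw [← map_verschiebung, ← hG, map_add, map_sub]
  simp [map_teichmuller, hp.out.ne_zero, hp.out.ne_zero.symm]

variable {K Ω : Type*} [Field K] [Field Ω] [Algebra K Ω] [CharP Ω p] {n : ℕ} {b : K}
  {α : WittVector p Ω}

theorem IsASWRoot.coeff_zero_pow (hα : IsASWRoot (n + 1) (teichmuller p b) α) :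
    α.coeff 0 ^ p - α.coeff 0 = algebraMap K Ω b := by
  have h := truncate_eq_iff.1 hα 0 n.succ_pos
  rwa [map_teichmuller, teichmuller_coeff_zero, sub_coeff_zero, coeff_frobenius_charP] at h

variable [IsAlgClosed Ω] [Algebra.IsAlgebraic K Ω]

theorem IsASWRoot.isNormFrom_norm
    (hn : ∀ (F : IntermediateField K Ω) (c : F), c ≠ 0 → SymbolVanishes Ω n (teichmuller p c) c)
    (hb : b ≠ 0) (hα : IsASWRoot (n + 1) (teichmuller p b) α) (F : IntermediateField K Ω)
    [FiniteDimensional K F] {t : F} (ht : (t : Ω) = α.coeff 0) :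
    IsNormFrom (coeffField K (n + 1) α) (Algebra.norm K t) := by
  have hF : CharP F p := (algebraMap F Ω).charP (algebraMap F Ω).injective p
  have : Algebra.IsAlgebraic F Ω := Algebra.IsAlgebraic.tower_top (K := K) F
  let : Algebra (ZMod p) F := ZMod.algebra F p
  have htb := hα.coeff_zero_pow
  rw [← ht] at htb
  have ht0 : t ≠ 0 := by
    rintro rfl
    apply hb
    apply (algebraMap K Ω).injective
    rw [← htb, map_zero, ZeroMemClass.coe_zero, zero_pow hp.out.ne_zero, sub_zero]
  obtain ⟨β, hβ⟩ : ∃ β, α - teichmuller p (t : Ω) = verschiebung β := by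
    refine ⟨_, eq_iterate_verschiebung (n := 1) fun k hk => ?_⟩
    obtain rfl : k = 0 := by lia
    rw [sub_coeff_zero, teichmuller_coeff_zero, ht, sub_self]
  obtain ⟨G, hG0, hG⟩ := exists_verschiebung_eq_teichmuller_sub p
  set φ := (Polynomial.aeval t : Polynomial (ZMod p) →ₐ[ZMod p] F).toRingHom with hφ
  have hβroot : IsASWRoot n (map φ G) β := by
    unfold IsASWRoot at hα ⊢
    have h1 : verschiebung (frobenius β - β) =
        (frobenius α - α) - (teichmuller p ((t : Ω) ^ p) - teichmuller p (t : Ω)) := by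
      rw [map_sub, verschiebung_frobenius_comm, ← hβ, map_sub, frobenius_teichmuller]
      ring
    have h2 : verschiebung (map (algebraMap F Ω) (map φ G)) = map (algebraMap K Ω) (teichmuller p b)
        - (teichmuller p ((t : Ω) ^ p) - teichmuller p (t : Ω)) := by
      rw [← map_verschiebung, ← map_verschiebung, ← hG, map_map, map_add, map_sub,
        map_teichmuller, map_teichmuller, map_teichmuller, map_teichmuller, ← htb]
      have hX : (algebraMap F Ω).comp φ Polynomial.X = t := by simp [hφ]
      rw [map_sub, map_pow, hX]
      ring
    rw [← truncate_succ_verschiebung, h1, h2, map_sub (truncate _), hα, ← map_sub]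
  have hnorm := symbolVanishes_map_aeval (Ω := Ω) (hn F) ht0 0 G hG0 β hβroot
  have hle : coeffField K (n + 1) α ≤ (coeffField F n β).restrictScalars K := by
    rw [coeffField_le_iff]
    intro i hi
    obtain ⟨a, ha⟩ := coeffField_le_iff_exists.1 (le_refl (coeffField F n β))
    have h1 : truncate (n + 1) (map (algebraMap (coeffField F n β) Ω)
        (teichmuller p (algebraMap F _ t) + verschiebung a)) = truncate (n + 1) α := by
      rw [map_add, map_teichmuller, map_verschiebung, eq_add_of_sub_eq hβ, map_add,
        truncate_succ_verschiebung.2 ha, ← map_add, add_comm (verschiebung β)]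
      rfl
    rw [← truncate_eq_iff.1 h1 i hi, map_coeff]
    exact Subtype.property _
  have : FiniteDimensional K ((coeffField F n β).restrictScalars K) :=
    FiniteDimensional.trans K F (coeffField F n β)
  exact .mono hle hnorm.norm_restrictScalars

variable [CharP K p] in
theorem symbolVanishes_teichmuller_succ
    (hn : ∀ (F : IntermediateField K Ω) (c : F), c ≠ 0 → SymbolVanishes Ω n (teichmuller p c) c)
    (hb : b ≠ 0) : SymbolVanishes Ω (n + 1) (teichmuller p b) b := by
  intro α hα
  set F := coeffField K 1 α with hF
  have : CharP F p := (algebraMap F Ω).charP (algebraMap F Ω).injective p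
  let t : F := ⟨α.coeff 0, coeff_mem_coeffField α one_pos⟩
  have htb : t ^ p - t = algebraMap K F b := by
    apply (algebraMap F Ω).injective
    rw [map_sub, map_pow]
    exact hα.coeff_zero_pow
  have hgal : IsGalois K F :=
    IsASWRoot.isGalois_coeffField (γ := teichmuller p b) (truncate_of_le (by lia) hα)
  have hpow : IsNormFrom (coeffField K (n + 1) α) (b ^ Module.finrank K F) := by
    rw [← Algebra.norm_algebraMap (S := F), ← htb, ← prod_add_zmod_cast, map_prod]
    refine Finset.prod_induction _ _ (fun _ _ => .mul) ⟨1, map_one _⟩ fun i _ => ?_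
    have hroot : ∀ k : ℕ, IsASWRoot (n + 1) (teichmuller p b) (α + (k : WittVector p Ω)) := by
      intro k
      have := hα.add (IsASWRoot.map_algebraMap (n + 1) (k : WittVector p K))
      rwa [map_natCast, map_natCast, sub_self, add_zero] at this
    rw [← coeffField_eq_of_truncate_eq_add_natCast (k := i.val)
      (β := α + (i.val : WittVector p Ω)) (by rw [map_add, map_natCast])]
    refine (hroot _).isNormFrom_norm hn hb F ?_
    rw [add_coeff_zero, natCast_coeff_zero]
    conv_lhs => rw [← ZMod.natCast_zmod_val i]
    rw [map_natCast]
    rfl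
  by_cases hlt : Module.finrank K F < p
  · obtain ⟨s, hs⟩ := hα.exists_isNormFrom_pow b
    refine IsNormFrom.of_isCoprime hb (a := (Module.finrank K F : ℕ)) (b := (p ^ s : ℕ)) ?_
      (by rwa [zpow_natCast]) (by rwa [zpow_natCast])
    rw [Nat.isCoprime_iff_coprime]
    exact Nat.Coprime.pow_right s
      (Nat.coprime_of_lt_prime Module.finrank_pos.ne' hlt hp.out).symm
  · convert hα.isNormFrom_norm hn hb F (t := t) rfl
    apply (algebraMap K F).injective
    have hψ : ∀ σ : Gal(F/K), ∃ i : ZMod p, ZMod.castHom dvd_rfl F i = σ t - t := by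
      intro σ
      change σ t - t ∈ (ZMod.castHom dvd_rfl F).fieldRange
      rw [ZMod.fieldRange_castHom_eq_bot, Subfield.mem_bot_iff_pow_eq_self F p, sub_pow_char]
      have := congrArg σ htb
      rw [map_sub, map_pow, AlgEquiv.commutes] at this
      linear_combination this - htb
    choose ψ hψ using hψ
    have hinj : Function.Injective ψ := by
      intro σ τ h
      have h1 : σ t = τ t := sub_left_injective ((hψ σ).symm.trans (h ▸ hψ τ))
      have h2 : (σ : F →ₐ[K] F) = τ := by
        refine IntermediateField.algHom_ext_of_eq_adjoin _ hF ?_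
        rintro x ⟨i, hi, rfl⟩
        obtain rfl : i = 0 := by lia
        exact h1
      exact AlgEquiv.ext fun x => DFunLike.congr_fun h2 x
    have hbij : Function.Bijective ψ := by
      rw [Fintype.bijective_iff_injective_and_card]
      refine ⟨hinj, le_antisymm (Fintype.card_le_of_injective ψ hinj) ?_⟩
      rw [ZMod.card, ← Nat.card_eq_fintype_card, IsGalois.card_aut_eq_finrank]
      lia
    rw [Algebra.norm_eq_prod_automorphisms, ← htb, ← prod_add_zmod_cast]
    refine (Fintype.prod_bijective ψ hbij _ _ fun σ => ?_).symm
    rw [hψ]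
    ring

end Induction

theorem symbolVanishes_teichmuller_of_universe {p : ℕ} [hp : Fact p.Prime] {Ω : Type v}
    [Field Ω] [IsAlgClosed Ω] [CharP Ω p] (n : ℕ) :
    ∀ (K : Type v) [Field K] [Algebra K Ω] [Algebra.IsAlgebraic K Ω] (b : K), b ≠ 0 →
      SymbolVanishes Ω n (teichmuller p b) b := by
  induction n with
  | zero =>
    intro K _ _ _ b _
    have : CharP K p := (algebraMap K Ω).charP (algebraMap K Ω).injective p
    exact (SymbolVanishes.zero 0 b).congr (truncate_eq_iff.2 fun i hi => absurd hi i.not_lt_zero)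
  | succ n ih =>
    intro K _ _ _ b hb
    have : CharP K p := (algebraMap K Ω).charP (algebraMap K Ω).injective p
    refine symbolVanishes_teichmuller_succ (fun F c hc => ?_) hb
    have : Algebra.IsAlgebraic F Ω := Algebra.IsAlgebraic.tower_top (K := K) F
    exact ih F c hc

theorem symbolVanishes_teichmuller {p : ℕ} [hp : Fact p.Prime] {K Ω : Type*} [Field K] [Field Ω]
    [Algebra K Ω] [IsAlgClosed Ω] [Algebra.IsAlgebraic K Ω] [CharP K p] [CharP Ω p] (n : ℕ)
    {b : K} (hb : b ≠ 0) : SymbolVanishes Ω n (teichmuller p b) b := by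
  cases n with
  | zero =>
    exact (SymbolVanishes.zero 0 b).congr (truncate_eq_iff.2 fun i hi => absurd hi i.not_lt_zero)
  | succ n =>
    refine symbolVanishes_teichmuller_succ (fun F c hc => ?_) hb
    have : Algebra.IsAlgebraic F Ω := Algebra.IsAlgebraic.tower_top (K := K) F
    exact symbolVanishes_teichmuller_of_universe n F c hc

end WittVector

/-- Let `K` be a field of characteristic `p > 0`, `n ≥ 1`, `b ∈ K`, `b ≠ 0`.
Let `Ω` be an algebraic closure of `K` and `α ∈ W_n(Ω)` with `F(α) − α = [b]`. Then the
intermediate field `L = K(α₀,…,α_{n−1})` is finite over `K` and `b` is a norm from `L`,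
i.e. the Artin–Schreier–Witt symbol `[[b], b)_{p^n}` vanishes. -/
theorem teichmuller_symbol_vanishes
    (p n : ℕ) [Fact p.Prime] (hn : 1 ≤ n)
    (K AC : Type*) [Field K] [CharP K p] [Field AC] [Algebra K AC] [IsAlgClosure K AC]
    (b : K) (hb : b ≠ 0)
    (α : TruncatedWittVector p n AC)
    (hα : TruncatedWittVector.frob α - α = TruncatedWittVector.teich (algebraMap K AC b))
    (L : IntermediateField K AC)
    (hL : L = IntermediateField.adjoin K (Set.range fun i : Fin n => α.coeff i)) :
    FiniteDimensional K L ∧ ∃ x : L, x ≠ 0 ∧ Algebra.norm K x = b := by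
  have : IsAlgClosed AC := IsAlgClosure.isAlgClosed K
  have : Algebra.IsAlgebraic K AC := IsAlgClosure.isAlgebraic
  have : CharP AC p := charP_of_injective_algebraMap (algebraMap K AC).injective p
  have hroot : WittVector.IsASWRoot n (WittVector.teichmuller p b) α.out := by
    have h : WittVector.truncate n α.out = α := TruncatedWittVector.truncateFun_out α
    unfold WittVector.IsASWRoot
    rw [map_sub, h, WittVector.map_teichmuller]
    exact hα
  have hLα : L = WittVector.coeffField K n α.out := by
    rw [hL, WittVector.coeffField]
    congr 1
    ext x
    exact ⟨fun ⟨i, hi⟩ => ⟨i, i.2, by rw [← hi, TruncatedWittVector.coeff_out]⟩,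
      fun ⟨i, hi, hx⟩ =>
        ⟨⟨i, hi⟩, by rw [← hx]; exact (TruncatedWittVector.coeff_out α ⟨i, hi⟩).symm⟩⟩
  subst hLα
  obtain ⟨x, hx⟩ := WittVector.symbolVanishes_teichmuller n hb α.out hroot
  refine ⟨inferInstance, x, ?_, hx⟩
  rintro rfl
  exact hb (hx.symm.trans Algebra.norm_zero)
end
end

section
/- Let p be a prime, K a field of characteristic p, and n ≥ 1. Let T : W_n(K) → K be the ring homomorphism sending a truncated Witt vector to its first coefficient x.coeff 0, and let φ : Ω¹(W_n(K)) → Ω¹(K) be the induced additive map on absolute Kähler differentials (so φ(a·d(b)) = T(a)·d(T(b))). Then φ(M_n) = M_1 and φ⁻¹(M_1) = M_n + p·Ω¹(W_n(K)). Consequently, the induced homomorphism g_n : Ω¹(W_n(K))/M_n → Ω¹(K)/M_1 is surjective and its kernel is p·(Ω¹(W_n(K))/M_n). -/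
noncomputable section

namespace KaehlerDifferential

/-- An additive subgroup of `Ω[A⁄R]` contains the kernel of `Ω[A⁄R] → Ω[B⁄R]`, for `A → B`
surjective with kernel `I`, as soon as it contains all `a • D b` with `a ∈ I` or `b ∈ I`. -/
theorem ker_map_le_of_surjective {R A B : Type*} [CommRing R] [CommRing A] [CommRing B]
    [Algebra R A] [Algebra R B] [Algebra A B] [IsScalarTower R A B]
    (h : Function.Surjective (algebraMap A B)) (N : AddSubgroup (Ω[A⁄R]))
    (h₁ : ∀ a b : A, algebraMap A B a = 0 → a • D R A b ∈ N)
    (h₂ : ∀ a b : A, algebraMap A B b = 0 → a • D R A b ∈ N)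
    {ω : Ω[A⁄R]} (hω : map R R A B ω = 0) : ω ∈ N := by
  rw [← LinearMap.mem_ker, ker_map_of_surjective R A B h] at hω
  obtain ⟨x, hx, rfl⟩ := hω
  obtain ⟨s, hs⟩ := h.hasRightInverse
  let F : (B →₀ B) →+ Ω[A⁄R] ⧸ N := Finsupp.liftAddHom fun c =>
    AddMonoidHom.mk' (fun b => QuotientAddGroup.mk' N (s b • D R A (s c))) fun b b' => by
      rw [← map_add, ← add_smul]
      refine (QuotientAddGroup.mk'_eq_mk' N).2 ⟨(s b + s b' - s (b + b')) • D R A (s c),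
        h₁ _ _ (by simp [hs _]), ?_⟩
      rw [← add_smul]
      congr 1
      ring
  have key : (QuotientAddGroup.mk' N).comp
        (Finsupp.linearCombination A (D R A)).toAddMonoidHom =
      F.comp (Finsupp.mapRange.linearMap (Algebra.linearMap A B) ∘ₗ
        Finsupp.lmapDomain A A (algebraMap A B)).toAddMonoidHom := by
    refine Finsupp.addHom_ext fun a y => ?_
    simp only [F, AddMonoidHom.comp_apply, LinearMap.toAddMonoidHom_coe, LinearMap.comp_apply,
      Finsupp.linearCombination_single, Finsupp.lmapDomain_apply, Finsupp.mapDomain_single,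
      Finsupp.mapRange.linearMap_apply, Finsupp.mapRange_single, Algebra.linearMap_apply,
      Finsupp.liftAddHom_apply_single, AddMonoidHom.mk'_apply]
    refine (QuotientAddGroup.mk'_eq_mk' N).2
      ⟨(s (algebraMap A B y) - y) • D R A a + s (algebraMap A B y) •
        D R A (s (algebraMap A B a) - a),
        N.add_mem (h₁ _ _ (by simp [hs _])) (h₂ _ _ (by simp [hs _])), ?_⟩
    rw [map_sub, sub_smul, smul_sub]
    abel
  have hx' := DFunLike.congr_fun key x
  rw [← QuotientAddGroup.eq_zero_iff]
  refine hx'.trans ?_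
  have hx0 : (Finsupp.mapRange.linearMap (Algebra.linearMap A B) ∘ₗ
        Finsupp.lmapDomain A A (algebraMap A B)) x = 0 := hx
  simp only [AddMonoidHom.comp_apply, LinearMap.toAddMonoidHom_coe, hx0, map_zero]

end KaehlerDifferential

namespace TruncatedWittVector

variable {p n : ℕ} [Fact p.Prime] {R : Type*} [CommRing R]

theorem coeff_vers_zero (x : TruncatedWittVector p n R) (h : 0 < n) :
    (vers x).coeff ⟨0, h⟩ = 0 := by
  rw [vers, WittVector.coeff_truncate, WittVector.verschiebung_coeff_zero]

theorem coeff_vers_succ (x : TruncatedWittVector p n R) {i : ℕ} (h : i + 1 < n) :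
    (vers x).coeff ⟨i + 1, h⟩ = x.coeff ⟨i, i.lt_succ_self.trans h⟩ := by
  rw [vers, WittVector.coeff_truncate, WittVector.verschiebung_coeff_succ]
  exact coeff_out x ⟨i, i.lt_succ_self.trans h⟩

theorem coeff_frob [CharP R p] (x : TruncatedWittVector p n R) (i : Fin n) :
    (frob x).coeff i = x.coeff i ^ p := by
  rw [frob, WittVector.coeff_truncate, WittVector.coeff_frobenius_charP, coeff_out]

theorem coeff_teich_zero (a : R) (h : 0 < n) :
    (teich a : TruncatedWittVector p n R).coeff ⟨0, h⟩ = a := by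
  rw [teich, WittVector.coeff_truncate, WittVector.teichmuller_coeff_zero]

theorem truncate_out (x : TruncatedWittVector p n R) : WittVector.truncate n x.out = x :=
  truncateFun_out x

theorem frob_truncate [CharP R p] (x : WittVector p R) :
    frob (WittVector.truncate n x) = WittVector.truncate n (WittVector.frobenius x) := by
  ext i
  rw [coeff_frob, WittVector.coeff_truncate, WittVector.coeff_truncate,
    WittVector.coeff_frobenius_charP]

theorem exists_vers_eq {x : TruncatedWittVector p n R} (h : 0 < n)
    (hx : x.coeff ⟨0, h⟩ = 0) : ∃ y, vers y = x := by
  refine ⟨WittVector.truncate n (x.out.shift 1), ?_⟩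
  have h0 : ∀ i < 0 + 1, x.out.coeff i = 0 := by
    intro i hi
    obtain rfl : i = 0 := by omega
    exact (coeff_out x ⟨0, h⟩).trans hx
  have hs : x.out.shift 0 = x.out := by
    ext i
    rw [WittVector.shift_coeff, zero_add]
  rw [vers_truncate, WittVector.verschiebung_shift _ 0 h0, hs, truncate_out]

/-- Modulo `p`, the Frobenius lifts the `p`-th power map. -/
theorem exists_frob_eq_pow_add [CharP R p] (x : TruncatedWittVector p n R) :
    ∃ a y : TruncatedWittVector p n R, frob x = a ^ p + p * y := by
  set X := x.out
  have h : (X - WittVector.teichmuller p (X.coeff 0)).coeff 0 = 0 := by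
    have := map_sub (WittVector.constantCoeff (p := p) (R := R)) X
      (WittVector.teichmuller p (X.coeff 0))
    simpa [WittVector.constantCoeff_apply] using this
  have hs := WittVector.eq_iterate_verschiebung (n := 1)
    (x := X - WittVector.teichmuller p (X.coeff 0)) (fun i hi => by
      obtain rfl : i = 0 := by omega
      exact h)
  rw [Function.iterate_one] at hs
  set Y := (X - WittVector.teichmuller p (X.coeff 0)).shift 1
  have hT : WittVector.frobenius (WittVector.teichmuller p (X.coeff 0)) =
      WittVector.teichmuller p (X.coeff 0) ^ p := by
    rw [WittVector.frobenius_eq_map_frobenius, WittVector.map_teichmuller, _root_.frobenius_def,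
      map_pow]
  have hX : WittVector.frobenius X = WittVector.teichmuller p (X.coeff 0) ^ p + p * Y := by
    rw [← hT, mul_comm, ← WittVector.frobenius_verschiebung, ← map_add, ← hs, add_sub_cancel]
  refine ⟨WittVector.truncate n (WittVector.teichmuller p (X.coeff 0)),
    WittVector.truncate n Y, ?_⟩
  rw [frob, hX, map_add, map_mul, map_pow, map_natCast]

open KaehlerDifferential in
theorem exists_D_frob_eq_nsmul [CharP R p] (x : TruncatedWittVector p n R) :
    ∃ η : Ω[TruncatedWittVector p n R⁄ℤ], D ℤ _ (frob x) = p • η := by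
  obtain ⟨a, y, h⟩ := exists_frob_eq_pow_add x
  refine ⟨a ^ (p - 1) • D ℤ _ a + D ℤ _ y, ?_⟩
  rw [h, map_add, Derivation.leibniz_pow, Derivation.leibniz, Derivation.map_natCast, smul_zero,
    add_zero, Nat.cast_smul_eq_nsmul, smul_add]

section Differentials

open KaehlerDifferential

/-- Exact differentials lie in `N`, since `d y ≡ d (V y) ≡ d (V² y) ≡ ⋯ ≡ 0`. -/
theorem D_mem [CharP R p] {N : AddSubgroup (Ω[TruncatedWittVector p n R⁄ℤ])}
    (hN : ∀ x y : TruncatedWittVector p n R, frob x • D ℤ _ y - x • D ℤ _ (vers y) ∈ N)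
    (y : TruncatedWittVector p n R) : D ℤ _ y ∈ N := by
  have h1 : frob (1 : TruncatedWittVector p n R) = 1 := by
    rw [← map_one (WittVector.truncate n), frob_truncate, map_one]
  suffices H : ∀ k ≤ n, ∀ y : TruncatedWittVector p n R,
      (∀ i : Fin n, (i : ℕ) < n - k → y.coeff i = 0) → D ℤ _ y ∈ N from
    H n le_rfl y fun i hi => by omega
  intro k
  induction k with
  | zero =>
    intro _ y hy
    have : y = 0 := by
      ext i
      rw [hy i (by omega), coeff_zero]
    rw [this, map_zero]
    exact N.zero_mem
  | succ k ih =>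
    intro hk y hy
    have hv : D ℤ _ (vers y) ∈ N := by
      refine ih (by omega) _ fun i hi => ?_
      obtain ⟨i, hin⟩ := i
      cases i with
      | zero => exact coeff_vers_zero y hin
      | succ i => exact (coeff_vers_succ y hin).trans (hy _ (by simp at hi ⊢; omega))
    have := N.add_mem (hN 1 y) hv
    rwa [h1, one_smul, one_smul, sub_add_cancel] at this

theorem smul_D_vers_mem [CharP R p] {N : AddSubgroup (Ω[TruncatedWittVector p n R⁄ℤ])}
    (hN : ∀ x y : TruncatedWittVector p n R, frob x • D ℤ _ y - x • D ℤ _ (vers y) ∈ N)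
    (hp : ∀ η : Ω[TruncatedWittVector p n R⁄ℤ], p • η ∈ N)
    (x y : TruncatedWittVector p n R) :
    x • D ℤ _ (vers y) ∈ N := by
  obtain ⟨η, hη⟩ := exists_D_frob_eq_nsmul x
  have h1 : frob x • D ℤ _ y ∈ N := by
    have h := N.sub_mem (D_mem hN (frob x * y)) (hp (y • η))
    rwa [Derivation.leibniz, hη, smul_comm y p η, add_sub_cancel_right] at h
  have h := N.sub_mem h1 (hN x y)
  rwa [sub_sub_cancel] at h

theorem vers_smul_D_mem [CharP R p] {N : AddSubgroup (Ω[TruncatedWittVector p n R⁄ℤ])}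
    (hN : ∀ x y : TruncatedWittVector p n R, frob x • D ℤ _ y - x • D ℤ _ (vers y) ∈ N)
    (hp : ∀ η : Ω[TruncatedWittVector p n R⁄ℤ], p • η ∈ N)
    (x y : TruncatedWittVector p n R) :
    vers x • D ℤ _ y ∈ N := by
  have h := N.sub_mem (D_mem hN (vers x * y)) (smul_D_vers_mem hN hp y x)
  rwa [Derivation.leibniz, add_sub_cancel_right] at h

end Differentials

end TruncatedWittVector

/-- Let `T : W_n(K) → K` be the first-coefficient ring homomorphism and
`φ : Ω¹(W_n(K)) → Ω¹(K)` the induced additive map (`φ(a·d b) = T(a)·d(T b)`). Then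
`φ(M_n) = M_1` and `φ⁻¹(M_1) = M_n + p·Ω¹(W_n(K))`; consequently the induced map
`g_n : Ω¹(W_n(K))/M_n → Ω¹(K)/M_1` is surjective with kernel `p·(Ω¹(W_n(K))/M_n)`. -/
theorem truncation_M_image_and_preimage
    (p : ℕ) [Fact p.Prime] (K : Type*) [Field K] [CharP K p] (n : ℕ) (hn : 0 < n)
    (T : TruncatedWittVector p n K →+* K)
    (hT : ∀ x : TruncatedWittVector p n K, T x = x.coeff ⟨0, hn⟩)
    (φ : Ω[TruncatedWittVector p n K⁄ℤ] →+ Ω[K⁄ℤ])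
    (hφ : ∀ a b : TruncatedWittVector p n K,
      φ (a • KaehlerDifferential.D ℤ (TruncatedWittVector p n K) b) =
        T a • KaehlerDifferential.D ℤ K (T b))
    (Mn : AddSubgroup (Ω[TruncatedWittVector p n K⁄ℤ]))
    (hMn : Mn = AddSubgroup.closure
      ({ω : Ω[TruncatedWittVector p n K⁄ℤ] |
          ∃ x y : TruncatedWittVector p n K,
            ω = TruncatedWittVector.frob x • KaehlerDifferential.D ℤ _ y -
              x • KaehlerDifferential.D ℤ _ (TruncatedWittVector.vers y)} ∪
        {ω : Ω[TruncatedWittVector p n K⁄ℤ] |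
          ∃ c e : K, e ≠ 0 ∧
            ω = ((TruncatedWittVector.teich c ^ p - TruncatedWittVector.teich c) *
                  TruncatedWittVector.teich e⁻¹ : TruncatedWittVector p n K) •
                KaehlerDifferential.D ℤ (TruncatedWittVector p n K)
                  (TruncatedWittVector.teich e)}))
    (M1 : AddSubgroup (Ω[K⁄ℤ]))
    (hM1 : M1 = AddSubgroup.closure
      ({ω : Ω[K⁄ℤ] | ∃ c e : K, ω = c ^ p • KaehlerDifferential.D ℤ K e} ∪
        {ω : Ω[K⁄ℤ] | ∃ c e : K, e ≠ 0 ∧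
          ω = ((c ^ p - c) * e⁻¹) • KaehlerDifferential.D ℤ K e})) :
    AddSubgroup.map φ Mn = M1 ∧
    AddSubgroup.comap φ M1 =
      Mn ⊔ AddSubgroup.closure
        (Set.range fun η : Ω[TruncatedWittVector p n K⁄ℤ] => p • η) ∧
    ∀ g : (Ω[TruncatedWittVector p n K⁄ℤ] ⧸ Mn) →+ (Ω[K⁄ℤ] ⧸ M1),
      (∀ ω, g (QuotientAddGroup.mk' Mn ω) = QuotientAddGroup.mk' M1 (φ ω)) →
      Function.Surjective g ∧
        g.ker = AddSubgroup.closure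
          (Set.range fun η : Ω[TruncatedWittVector p n K⁄ℤ] ⧸ Mn => (p • η : Ω[TruncatedWittVector p n K⁄ℤ] ⧸ Mn)) := by
  let : Algebra (TruncatedWittVector p n K) K := T.toAlgebra
  have hTalg : ∀ x, algebraMap (TruncatedWittVector p n K) K x = T x := fun _ => rfl
  have hTteich : ∀ a, T (TruncatedWittVector.teich a) = a := fun a => by
    rw [hT, TruncatedWittVector.coeff_teich_zero]
  have hTfrob : ∀ x, T (TruncatedWittVector.frob x) = T x ^ p := fun x => by
    rw [hT, hT, TruncatedWittVector.coeff_frob]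
  have hTvers : ∀ x, T (TruncatedWittVector.vers x) = 0 := fun x => by
    rw [hT, TruncatedWittVector.coeff_vers_zero]
  have hsurj : Function.Surjective (algebraMap (TruncatedWittVector p n K) K) := fun a =>
    ⟨_, hTteich a⟩
  have hφmap : ∀ ω, φ ω = KaehlerDifferential.map ℤ ℤ (TruncatedWittVector p n K) K ω := by
    intro ω
    obtain ⟨x, rfl⟩ := KaehlerDifferential.linearCombination_surjective ℤ _ ω
    induction x using Finsupp.induction_linear with
    | zero => simp
    | add f g hf hg => rw [map_add, map_add, map_add, hf, hg]
    | single b a =>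
      rw [Finsupp.linearCombination_single, hφ, map_smul, KaehlerDifferential.map_D,
        algebra_compatible_smul K a, hTalg, hTalg]
  have hφsurj : Function.Surjective φ := fun ω => by
    obtain ⟨η, hη⟩ := KaehlerDifferential.map_surjective_of_surjective ℤ ℤ _ _ hsurj ω
    exact ⟨η, (hφmap η).trans hη⟩
  have hφp : ∀ η, φ (p • η) = 0 := fun η => by
    rw [map_nsmul, ← Nat.cast_smul_eq_nsmul K, CharP.cast_eq_zero, zero_smul]
  have hMn₁ : ∀ x y : TruncatedWittVector p n K, TruncatedWittVector.frob x •
      KaehlerDifferential.D ℤ _ y - x • KaehlerDifferential.D ℤ _ (TruncatedWittVector.vers y) ∈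
      Mn := fun x y => hMn ▸ AddSubgroup.subset_closure (Or.inl ⟨x, y, rfl⟩)
  have hMn₂ : ∀ c e : K, e ≠ 0 →
      ((TruncatedWittVector.teich c ^ p - TruncatedWittVector.teich c) *
          TruncatedWittVector.teich e⁻¹ : TruncatedWittVector p n K) •
        KaehlerDifferential.D ℤ (TruncatedWittVector p n K) (TruncatedWittVector.teich e) ∈ Mn :=
    fun c e he => hMn ▸ AddSubgroup.subset_closure (Or.inr ⟨c, e, he, rfl⟩)
  have himage : AddSubgroup.map φ Mn = M1 := by
    apply le_antisymm
    · rw [AddSubgroup.map_le_iff_le_comap, hMn, AddSubgroup.closure_le]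
      rintro _ (⟨x, y, rfl⟩ | ⟨c, e, he, rfl⟩)
      · rw [SetLike.mem_coe, AddSubgroup.mem_comap, map_sub, hφ, hφ, hTfrob, hTvers, map_zero,
          smul_zero, sub_zero, hM1]
        exact AddSubgroup.subset_closure (Or.inl ⟨_, _, rfl⟩)
      · rw [SetLike.mem_coe, AddSubgroup.mem_comap, hφ, map_mul, map_sub, map_pow, hTteich,
          hTteich, hTteich, hM1]
        exact AddSubgroup.subset_closure (Or.inr ⟨c, e, he, rfl⟩)
    · rw [hM1, AddSubgroup.closure_le]
      rintro _ (⟨c, e, rfl⟩ | ⟨c, e, he, rfl⟩)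
      · refine ⟨_, hMn₁ (TruncatedWittVector.teich c) (TruncatedWittVector.teich e), ?_⟩
        rw [map_sub, hφ, hφ, hTfrob, hTvers, map_zero, smul_zero, sub_zero, hTteich, hTteich]
      · refine ⟨_, hMn₂ c e he, ?_⟩
        rw [hφ, map_mul, map_sub, map_pow, hTteich, hTteich, hTteich]
  have hpreimage : AddSubgroup.comap φ M1 = Mn ⊔ AddSubgroup.closure
      (Set.range fun η : Ω[TruncatedWittVector p n K⁄ℤ] => p • η) := by
    apply le_antisymm
    · have hN : ∀ x y : TruncatedWittVector p n K, TruncatedWittVector.frob x •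
          KaehlerDifferential.D ℤ _ y - x • KaehlerDifferential.D ℤ _ (TruncatedWittVector.vers y) ∈
          Mn ⊔ AddSubgroup.closure
            (Set.range fun η : Ω[TruncatedWittVector p n K⁄ℤ] => p • η) := fun x y =>
        AddSubgroup.mem_sup_left (hMn₁ x y)
      have hp : ∀ η : Ω[TruncatedWittVector p n K⁄ℤ], p • η ∈ Mn ⊔ AddSubgroup.closure
            (Set.range fun η : Ω[TruncatedWittVector p n K⁄ℤ] => p • η) := fun η =>
        AddSubgroup.mem_sup_right (AddSubgroup.subset_closure ⟨η, rfl⟩)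
      intro ω hω
      rw [AddSubgroup.mem_comap, ← himage] at hω
      obtain ⟨m, hm, hmω⟩ := hω
      rw [← sub_add_cancel ω m]
      refine add_mem (KaehlerDifferential.ker_map_le_of_surjective hsurj _ ?_ ?_ ?_)
        (AddSubgroup.mem_sup_left hm)
      · intro a b ha
        obtain ⟨x, rfl⟩ := TruncatedWittVector.exists_vers_eq hn ((hT a).symm.trans ha)
        exact TruncatedWittVector.vers_smul_D_mem hN hp x b
      · intro a b hb
        obtain ⟨y, rfl⟩ := TruncatedWittVector.exists_vers_eq hn ((hT b).symm.trans hb)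
        exact TruncatedWittVector.smul_D_vers_mem hN hp a y
      · rw [← hφmap, map_sub, hmω, sub_self]
    · refine sup_le (AddSubgroup.map_le_iff_le_comap.1 himage.le) ?_
      rw [AddSubgroup.closure_le]
      rintro _ ⟨η, rfl⟩
      rw [SetLike.mem_coe, AddSubgroup.mem_comap, hφp]
      exact M1.zero_mem
  refine ⟨himage, hpreimage, fun g hg => ⟨?_, ?_⟩⟩
  · intro ω
    obtain ⟨ω, rfl⟩ := QuotientAddGroup.mk'_surjective M1 ω
    obtain ⟨η, rfl⟩ := hφsurj ω
    exact ⟨_, hg η⟩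
  · have hker : AddSubgroup.comap (QuotientAddGroup.mk' Mn) g.ker = AddSubgroup.comap φ M1 := by
      ext ω
      rw [AddSubgroup.mem_comap, AddMonoidHom.mem_ker, hg, AddSubgroup.mem_comap,
        QuotientAddGroup.mk'_apply, QuotientAddGroup.eq_zero_iff]
    rw [← AddSubgroup.map_comap_eq_self_of_surjective (QuotientAddGroup.mk'_surjective Mn) g.ker,
      hker, hpreimage, AddSubgroup.map_sup, QuotientAddGroup.map_mk'_self, bot_sup_eq,
      AddMonoidHom.map_closure, ← Set.range_comp,
      ← (QuotientAddGroup.mk'_surjective Mn).range_comp]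
    rfl
end
end
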